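/- arXiv:1802.01277 — 2 statements merged into one kernel-verified Lean document; each statement's English description precedes it below -/
import Mathlib

section
/- Let (x̄,λ̄) be a KKT point of the unperturbed problem (a,b)=(0,0) with M(x̄,0,0) ≠ {λ̄}. Suppose: (i) the set-valued map F(x) = g(x) − K is metrically subregular at x̄ for the origin; (ii) ⟨g'(x̄)ξ, ζ⟩ ≥ 0 for every (ξ,ζ) ∈ Σ(x̄,λ̄) ∩ Γ̃(x̄,λ̄), where Σ(x̄,λ̄) = {(ξ,ζ) : ∇²ₓₓL(x̄,λ̄)ξ + ∇g(x̄)*(ζ + ½∇Υ(g'(x̄)ξ)) = 0} and Γ̃(x̄,λ̄) = {(ξ,ζ) : g'(x̄)ξ ∈ C_K(g(x̄),λ̄), ∇g(x̄)*ζ ∈ ∇g(x̄)*(N_K(g(x̄)) + ℝ·λ̄)}; and (iii) ri(N_K(g(x̄))) ∩ M(x̄,0,0) ≠ ∅. Then the noncriticality of λ̄ implies that S_KKT is strongly calm at the origin for (x̄,λ̄). -/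
open Set Filter Topology Metric Pointwise
open scoped RealInnerProductSpace Classical

noncomputable section

/-- The normal cone of convex analysis: `N_K(z) = {l | ⟪l, y - z⟫ ≤ 0 ∀ y ∈ K}`,
empty when `z ∉ K`. -/
def nCone {E : Type*} [NormedAddCommGroup E] [InnerProductSpace ℝ E]
    (K : Set E) (z : E) : Set E :=
  {l | z ∈ K ∧ ∀ y ∈ K, ⟪l, y - z⟫ ≤ 0}

/-- The metric projection onto `K`: under the standing assumptions (`K` nonempty,
closed and convex in a finite-dimensional space) the distance minimizer exists and
is unique, so this choice-based definition is exactly the metric projection `Π_K`. -/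

def projK {E : Type*} [NormedAddCommGroup E] [InnerProductSpace ℝ E]
    (K : Set E) (z : E) : E :=
  if h : ∃ p, p ∈ K ∧ ∀ y ∈ K, ‖z - p‖ ≤ ‖z - y‖ then h.choose else 0

/-- A set `D` is a pointed closed convex cone. -/
def PointedClosedConvexCone {E : Type*} [NormedAddCommGroup E] [NormedSpace ℝ E]
    (D : Set E) : Prop :=
  IsClosed D ∧ Convex ℝ D ∧ (∀ t : ℝ, 0 ≤ t → ∀ z ∈ D, t • z ∈ D) ∧ D ∩ (-D) ⊆ {0}

/-- `K` is `C²`-cone reducible at `y`: near `y`, `K` is the inverse image of a pointed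
closed convex cone `D` under a twice continuously differentiable map `Ξ` with `Ξ y = 0`
and `Ξ'(y)` surjective.  (Since the target of the reduction is a finite-dimensional
space of dimension at most `dim Y`, it can be taken to be a Euclidean space.) -/
def C2ConeReducibleAt {Y : Type*} [NormedAddCommGroup Y] [InnerProductSpace ℝ Y]
    (K : Set Y) (y : Y) : Prop :=
  ∃ (m : ℕ) (U : Set Y) (D : Set (EuclideanSpace ℝ (Fin m)))
    (Ξ : Y → EuclideanSpace ℝ (Fin m)),
      IsOpen U ∧ y ∈ U ∧ PointedClosedConvexCone D ∧ ContDiffOn ℝ 2 Ξ U ∧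
      Ξ y = 0 ∧ Function.Surjective (fderiv ℝ Ξ y) ∧ K ∩ U = {y' ∈ U | Ξ y' ∈ D}

/-- `K` is `C²`-cone reducible (at every point of `K`). -/
def C2ConeReducible {Y : Type*} [NormedAddCommGroup Y] [InnerProductSpace ℝ Y]
    (K : Set Y) : Prop :=
  ∀ y ∈ K, C2ConeReducibleAt K y

/-- Calmness of a set-valued map `F` at `z0` for `w0 ∈ F z0`. -/
def Calm {Z W : Type*} [NormedAddCommGroup Z] [NormedAddCommGroup W]
    (F : Z → Set W) (z0 : Z) (w0 : W) : Prop :=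
  ∃ κ ε δ : ℝ, 0 < κ ∧ 0 < ε ∧ 0 < δ ∧
    ∀ z : Z, ‖z - z0‖ ≤ ε → ∀ w ∈ F z, ‖w - w0‖ ≤ δ →
      ∃ w' ∈ F z0, ‖w - w'‖ ≤ κ * ‖z - z0‖

/-- Isolated calmness of a set-valued map `F` at `z0` for `w0 ∈ F z0`. -/
def IsolatedCalm {Z W : Type*} [NormedAddCommGroup Z] [NormedAddCommGroup W]
    (F : Z → Set W) (z0 : Z) (w0 : W) : Prop :=
  ∃ κ ε δ : ℝ, 0 < κ ∧ 0 < ε ∧ 0 < δ ∧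
    ∀ z : Z, ‖z - z0‖ ≤ ε → ∀ w ∈ F z, ‖w - w0‖ ≤ δ →
      ‖w - w0‖ ≤ κ * ‖z - z0‖

/-- Metric subregularity of `F` at `z0` for `w0 ∈ F z0`:
`dist(z, F⁻¹(w0)) ≤ κ · dist(w0, F z ∩ B_δ(w0))` for `z` near `z0`; since the
right-hand side is an infimum over `F z ∩ B_δ(w0)` (`= +∞` when empty), this is
equivalently stated pointwise. -/
def MetricallySubregular {Z W : Type*} [NormedAddCommGroup Z] [NormedAddCommGroup W]
    (F : Z → Set W) (z0 : Z) (w0 : W) : Prop :=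
  ∃ κ ε δ : ℝ, 0 < κ ∧ 0 < ε ∧ 0 < δ ∧
    ∀ z : Z, ‖z - z0‖ ≤ ε → ∀ w ∈ F z, ‖w - w0‖ ≤ δ →
      infDist z {z' : Z | w0 ∈ F z'} ≤ κ * ‖w0 - w‖

/-- `φ` has directional derivative `w` at `z` in direction `h`. -/
def HasDirDeriv {E : Type*} [NormedAddCommGroup E] [NormedSpace ℝ E]
    (φ : E → E) (z h w : E) : Prop :=
  Tendsto (fun t : ℝ => t⁻¹ • (φ (z + t • h) - φ z)) (𝓝[>] (0 : ℝ)) (𝓝 w)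

/-- The contingent (Bouligand) tangent cone to `s` at `z`. -/
def contCone {E : Type*} [NormedAddCommGroup E] [NormedSpace ℝ E]
    (s : Set E) (z : E) : Set E :=
  {w | ∃ (t : ℕ → ℝ) (v : ℕ → E), (∀ n, 0 < t n) ∧ Tendsto t atTop (𝓝 0) ∧
        Tendsto v atTop (𝓝 w) ∧ ∀ n, z + t n • v n ∈ s}

/-- The negative polar cone of a set. -/
def negPolar {E : Type*} [NormedAddCommGroup E] [InnerProductSpace ℝ E]
    (C : Set E) : Set E :=
  {z | ∀ d ∈ C, ⟪z, d⟫ ≤ 0}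

/-- The critical cone `C_K(y,u) = T_K(y) ∩ u^⊥`. -/
def criticalCone {E : Type*} [NormedAddCommGroup E] [InnerProductSpace ℝ E]
    (K : Set E) (y u : E) : Set E :=
  contCone K y ∩ {d | ⟪u, d⟫ = 0}

/-- The (outer) second-order tangent set `T²_K(y,h)`. -/
def secondOrderTangent {E : Type*} [NormedAddCommGroup E] [NormedSpace ℝ E]
    (K : Set E) (y h : E) : Set E :=
  {w | ∃ (t : ℕ → ℝ) (v : ℕ → E), (∀ n, 0 < t n) ∧ Tendsto t atTop (𝓝 0) ∧
        Tendsto v atTop (𝓝 w) ∧ ∀ n, y + t n • h + ((t n) ^ 2 / 2) • v n ∈ K}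

variable {X Y : Type*} [NormedAddCommGroup X] [InnerProductSpace ℝ X]
  [FiniteDimensional ℝ X] [NormedAddCommGroup Y] [InnerProductSpace ℝ Y]
  [FiniteDimensional ℝ Y]

/-- The KKT solution map of the canonically perturbed problem:
`∇f(x) + ∇g(x)*λ = a` and `λ ∈ N_K(g(x) − b)`. -/
def sKKT (f : X → ℝ) (g : X → Y) (K : Set Y) (a : X) (b : Y) : Set (X × Y) :=
  {p | gradient f p.1 + ContinuousLinearMap.adjoint (fderiv ℝ g p.1) p.2 = a ∧
       p.2 ∈ nCone K (g p.1 - b)}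

/-- The multiplier set map `M(x,a,b)`. -/
def mSet (f : X → ℝ) (g : X → Y) (K : Set Y) (x : X) (a : X) (b : Y) : Set Y :=
  {l | (x, l) ∈ sKKT f g K a b}

/-- The stationary point map `X_KKT(a,b)`. -/
def xKKT (f : X → ℝ) (g : X → Y) (K : Set Y) (a : X) (b : Y) : Set X :=
  {x | ∃ l, (x, l) ∈ sKKT f g K a b}

/-- The Hessian `∇²ₓₓL(x,λ)` of the Lagrangian `L(·,λ)` at `x`. -/
def hessLxx (f : X → ℝ) (g : X → Y) (x : X) (l : Y) : X →L[ℝ] X :=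
  fderiv ℝ (fun u => gradient (fun v => f v + ⟪l, g v⟫) u) x

/-- The multiplier `l0` is noncritical: the only solutions `(ξ,v)` of
`∇²ₓₓL(x̄,λ̄)ξ + ∇g(x̄)*v = 0`, `g'(x̄)ξ − Π_K'(g(x̄)+λ̄; g'(x̄)ξ+v) = 0` have `ξ = 0`. -/
def Noncritical (f : X → ℝ) (g : X → Y) (K : Set Y) (x0 : X) (l0 : Y) : Prop :=
  ∀ (ξ : X) (v : Y),
    hessLxx f g x0 l0 ξ + ContinuousLinearMap.adjoint (fderiv ℝ g x0) v = 0 →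
    HasDirDeriv (projK K) (g x0 + l0) (fderiv ℝ g x0 ξ + v) (fderiv ℝ g x0 ξ) →
    ξ = 0

/-- Strong calmness of `S_KKT` at the origin for `(x̄,λ̄)`. -/
def StrongCalm (f : X → ℝ) (g : X → Y) (K : Set Y) (x0 : X) (l0 : Y) : Prop :=
  ∃ δ ε κ : ℝ, 0 < δ ∧ 0 < ε ∧ 0 < κ ∧
    ∀ (a : X) (b : Y), ‖(a, b)‖ ≤ δ →
      ∀ (x : X) (l : Y), (x, l) ∈ sKKT f g K a b → ‖(x, l) - (x0, l0)‖ ≤ ε →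
        ‖x - x0‖ + infDist l (mSet f g K x0 0 0) ≤ κ * ‖(a, b)‖

/-- Pseudo-isolated calmness of `X_KKT` at the origin for `x̄` (relative to `λ̄`). -/
def PseudoIsolatedCalm (f : X → ℝ) (g : X → Y) (K : Set Y) (x0 : X) (l0 : Y) : Prop :=
  ∃ ε δ κ : ℝ, 0 < ε ∧ 0 < δ ∧ 0 < κ ∧
    ∀ (a : X) (b : Y), ‖(a, b)‖ ≤ δ →
      ∀ (x : X) (l : Y), (x, l) ∈ sKKT f g K a b → ‖(x, l) - (x0, l0)‖ ≤ ε →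
        ‖x - x0‖ ≤ κ * ‖(a, b)‖


lemma aux_curve {E F : Type*} [NormedAddCommGroup E] [NormedSpace ℝ E] [CompleteSpace E]
    [NormedAddCommGroup F] [NormedSpace ℝ F] [FiniteDimensional ℝ F]
    {φ : E → F} {φ' : E →L[ℝ] F} {y : E} (hφ : HasStrictFDerivAt φ φ' y)
    (hs : Function.Surjective φ') (w : E) :
    ∃ c : ℝ → E, c 0 = y ∧ HasDerivAt c w 0 ∧
      ∀ᶠ s in 𝓝 (0 : ℝ), φ (c s) = φ y + s • φ' w := by
  have : CompleteSpace F := FiniteDimensional.complete ℝ F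
  obtain ⟨R, hR⟩ := ContinuousLinearMap.exists_rightInverse_of_surjective φ'
    (LinearMap.range_eq_top.mpr hs)
  have hRz : ∀ z, φ' (R z) = z := fun z => by
    have := congrArg (fun T : F →L[ℝ] F => T z) hR
    simpa using this
  let G : ℝ × F → F := fun p => φ (y + p.1 • w + R p.2) - p.1 • φ' w
  let inn : ℝ × F →L[ℝ] E :=
    (ContinuousLinearMap.fst ℝ ℝ F).smulRight w + R.comp (ContinuousLinearMap.snd ℝ ℝ F)
  let G' : ℝ × F →L[ℝ] F := φ'.comp inn - (ContinuousLinearMap.fst ℝ ℝ F).smulRight (φ' w)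
  have hG : HasStrictFDerivAt G G' (0 : ℝ × F) := by
    have h1 : HasStrictFDerivAt (fun p : ℝ × F => y + p.1 • w + R p.2) inn 0 := by
      have := (inn.hasStrictFDerivAt (x := (0 : ℝ × F))).const_add y
      have e : (fun p : ℝ × F => y + p.1 • w + R p.2) = fun x => y + inn x := by
        funext p
        simp [inn, add_assoc]
      rw [e]; exact this
    have h2 : HasStrictFDerivAt φ φ' ((fun p : ℝ × F => y + p.1 • w + R p.2) 0) := by
      simpa using hφ
    have h3 := (h2.comp (0 : ℝ × F) h1).sub
      (((ContinuousLinearMap.fst ℝ ℝ F).smulRight (φ' w)).hasStrictFDerivAt (x := (0 : ℝ × F)))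
    exact h3
  have hinr : G' ∘L .inr ℝ ℝ F = ContinuousLinearMap.id ℝ F := by
    ext z; simp [G', inn, hRz]
  have hinl : G' ∘L .inl ℝ ℝ F = 0 := by
    ext; simp [G', inn]
  have hinv : (G' ∘L .inr ℝ ℝ F).IsInvertible := by
    rw [hinr]; exact ⟨ContinuousLinearEquiv.refl ℝ F, rfl⟩
  have hd := hG.hasStrictFDerivAt_implicitFunctionOfProdDomain hinv
  have hev := hG.eventually_apply_implicitFunctionOfProdDomain hinv
  have h0 := (hG.eventually_apply_eq_iff_implicitFunctionOfProdDomain hinv).self_of_nhds.mp rfl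
  set ψ := hG.implicitFunctionOfProdDomain hinv
  rw [hinl] at hd
  simp only [Prod.fst_zero, Prod.snd_zero] at hd hev h0
  refine ⟨fun s => y + s • w + R (ψ s), by simp [h0], ?_, ?_⟩
  · have h1 : HasDerivAt ψ 0 0 := by
      have := hd.hasFDerivAt.hasDerivAt
      simpa using this
    have h2 : HasDerivAt (fun s => R (ψ s)) (R 0) 0 := R.hasFDerivAt.comp_hasDerivAt 0 h1
    have h3 : HasDerivAt (fun s : ℝ => y + s • w) w 0 := by
      simpa using ((hasDerivAt_id (0 : ℝ)).smul_const w).const_add y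
    have h4 := h3.add h2
    rw [map_zero, add_zero] at h4
    exact h4
  · filter_upwards [hev] with s hs
    have : φ (y + s • w + R (ψ s)) - s • φ' w = φ y := by simpa [G] using hs
    rw [← this]; abel

section red
variable {Z : Type*} [NormedAddCommGroup Z] [InnerProductSpace ℝ Z] [FiniteDimensional ℝ Z]

lemma aux_cone_normal {D : Set Z} (hD : PointedClosedConvexCone D) {z μ : Z}
    (h : μ ∈ nCone D z) : ⟪μ, z⟫ = 0 ∧ μ ∈ nCone D 0 := by
  obtain ⟨hz, h⟩ := h
  have h0 : (0 : Z) ∈ D := by simpa using hD.2.2.1 0 le_rfl z hz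
  have h1 := h 0 h0
  have h2 := h _ (hD.2.2.1 2 (by norm_num) z hz)
  have h3 : ⟪μ, z⟫ = 0 := by
    simp only [two_smul, add_sub_cancel_right, zero_sub, inner_neg_right] at h1 h2
    linarith
  refine ⟨h3, h0, fun y hy => ?_⟩
  have := h y hy
  rw [inner_sub_right, h3] at this
  simpa using this

/-- normals of `D` pull back to normals of `K` -/
lemma aux_pull {K U : Set Y} {D : Set Z} {Ξ : Y → Z} (hKcv : Convex ℝ K)
    (hU : IsOpen U) (hred : K ∩ U = {y ∈ U | Ξ y ∈ D}) {y : Y} (hyK : y ∈ K) (hyU : y ∈ U)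
    {T : Y →L[ℝ] Z} (hT : HasFDerivAt Ξ T y) {μ : Z} (hμ : μ ∈ nCone D (Ξ y)) :
    ContinuousLinearMap.adjoint T μ ∈ nCone K y := by
  refine ⟨hyK, fun k hk => ?_⟩
  rw [ContinuousLinearMap.adjoint_inner_left]
  have hl : HasDerivAt (fun s : ℝ => y + s • (k - y)) (k - y) 0 := by
    simpa using ((hasDerivAt_id (0 : ℝ)).smul_const (k - y)).const_add y
  have hT' : HasFDerivAt Ξ T ((fun s : ℝ => y + s • (k - y)) 0) := by simpa using hT
  have h1 : HasDerivAt (fun s : ℝ => Ξ (y + s • (k - y))) (T (k - y)) 0 :=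
    hT'.comp_hasDerivAt 0 hl
  have h2 : HasDerivAt (fun s : ℝ => ⟪μ, Ξ (y + s • (k - y))⟫) ⟪μ, T (k - y)⟫ 0 := by
    simpa using (hasDerivAt_const (0 : ℝ) μ).inner ℝ h1
  have h3 := h2.tendsto_slope_zero_right
  refine le_of_tendsto h3 ?_
  have hnU : ∀ᶠ s in 𝓝 (0 : ℝ), y + s • (k - y) ∈ U := by
    have : Tendsto (fun s : ℝ => y + s • (k - y)) (𝓝 0) (𝓝 (y + (0 : ℝ) • (k - y))) :=
      hl.continuousAt
    exact this (hU.mem_nhds (by simpa using hyU))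
  have hlt : ∀ᶠ s in 𝓝 (0 : ℝ), s < 1 := gt_mem_nhds (by norm_num)
  filter_upwards [self_mem_nhdsWithin, nhdsWithin_le_nhds hnU, nhdsWithin_le_nhds hlt]
    with s hs hsU hs1
  have hs0 : (0 : ℝ) < s := hs
  have hK : y + s • (k - y) ∈ K := hKcv.add_smul_sub_mem hyK hk ⟨hs0.le, hs1.le⟩
  have hDm : Ξ (y + s • (k - y)) ∈ D := by
    have : y + s • (k - y) ∈ K ∩ U := ⟨hK, hsU⟩
    rw [hred] at this; exact this.2
  have := hμ.2 _ hDm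
  simp only [zero_add, zero_smul, add_zero, smul_eq_mul]
  rw [← inner_sub_right]
  exact mul_nonpos_of_nonneg_of_nonpos (by positivity) this

/-- normals of `K` come from normals of `D` -/
lemma aux_push {K U : Set Y} {D : Set Z} {Ξ : Y → Z} (hDcv : Convex ℝ D)
    (hU : IsOpen U) (hred : K ∩ U = {y ∈ U | Ξ y ∈ D}) {y : Y} (hyK : y ∈ K) (hyU : y ∈ U)
    {T : Y →L[ℝ] Z} (hT : HasStrictFDerivAt Ξ T y) (hs : Function.Surjective T)
    {l : Y} (hl : l ∈ nCone K y) :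
    ∃ μ ∈ nCone D (Ξ y), l = ContinuousLinearMap.adjoint T μ := by
  have hyD : Ξ y ∈ D := by
    have : y ∈ K ∩ U := ⟨hyK, hyU⟩
    rw [hred] at this; exact this.2
  have key : ∀ w : Y, Ξ y + T w ∈ D → ⟪l, w⟫ ≤ 0 := by
    intro w hw
    obtain ⟨c, hc0, hc, hcev⟩ := aux_curve hT hs w
    have h2 : HasDerivAt (fun s : ℝ => ⟪l, c s⟫) ⟪l, w⟫ 0 := by
      simpa using (hasDerivAt_const (0 : ℝ) l).inner ℝ hc
    refine le_of_tendsto h2.tendsto_slope_zero_right ?_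
    have hnU : ∀ᶠ s in 𝓝 (0 : ℝ), c s ∈ U :=
      hc.continuousAt (hU.mem_nhds (by simpa [hc0] using hyU))
    have hlt : ∀ᶠ s in 𝓝 (0 : ℝ), s < 1 := gt_mem_nhds (by norm_num)
    filter_upwards [self_mem_nhdsWithin, nhdsWithin_le_nhds hnU, nhdsWithin_le_nhds hlt,
      nhdsWithin_le_nhds hcev] with s hs hsU hs1 hsc
    have hs0 : (0 : ℝ) < s := hs
    have hDm : Ξ (c s) ∈ D := by
      rw [hsc]
      have := hDcv.add_smul_sub_mem hyD hw (t := s) ⟨hs0.le, hs1.le⟩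
      simpa using this
    have hK : c s ∈ K := by
      have : c s ∈ K ∩ U := by rw [hred]; exact ⟨hsU, hDm⟩
      exact this.1
    have := hl.2 _ hK
    simp only [zero_add, smul_eq_mul, hc0]
    rw [← inner_sub_right]
    exact mul_nonpos_of_nonneg_of_nonpos (by positivity) this
  have hker : ∀ w, T w = 0 → ⟪l, w⟫ = 0 := by
    intro w hw
    have h1 := key w (by simpa [hw] using hyD)
    have h2 := key (-w) (by simpa [hw] using hyD)
    rw [inner_neg_right] at h2
    linarith
  obtain ⟨R, hR⟩ := ContinuousLinearMap.exists_rightInverse_of_surjective T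
    (LinearMap.range_eq_top.mpr hs)
  have hRz : ∀ z, T (R z) = z := fun z => by
    have := congrArg (fun T : Z →L[ℝ] Z => T z) hR
    simpa using this
  refine ⟨ContinuousLinearMap.adjoint R l, ⟨hyD, fun d hd => ?_⟩, ?_⟩
  · rw [ContinuousLinearMap.adjoint_inner_left]
    exact key _ (by rw [hRz]; simpa using hd)
  · refine ext_inner_right ℝ fun w => ?_
    rw [ContinuousLinearMap.adjoint_inner_left, ContinuousLinearMap.adjoint_inner_left]
    have := hker (w - R (T w)) (by simp [hRz])
    rw [inner_sub_right] at this
    linarith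

end red

lemma aux_proj {K : Set Y} (hKcl : IsClosed K) (hKcv : Convex ℝ K) {y l : Y}
    (hl : l ∈ nCone K y) (z : Y) : ‖projK K z - y‖ ≤ ‖z - (y + l)‖ := by
  have hne : K.Nonempty := ⟨y, hl.1⟩
  have hex : ∃ p, p ∈ K ∧ ∀ y ∈ K, ‖z - p‖ ≤ ‖z - y‖ := by
    obtain ⟨p, hp, hd⟩ := hKcl.exists_infDist_eq_dist hne z
    refine ⟨p, hp, fun k hk => ?_⟩
    rw [← dist_eq_norm, ← dist_eq_norm, ← hd]
    exact infDist_le_dist_of_mem hk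
  have hp : projK K z ∈ K ∧ ∀ y ∈ K, ‖z - projK K z‖ ≤ ‖z - y‖ := by
    unfold projK
    rw [dif_pos hex]
    exact hex.choose_spec
  set p := projK K z
  have : Nonempty K := hne.to_subtype
  have hinf : ‖z - p‖ = ⨅ w : K, ‖z - w‖ := by
    apply le_antisymm
    · exact le_ciInf fun w => hp.2 w w.2
    · exact ciInf_le ⟨0, by rintro _ ⟨w, rfl⟩; exact norm_nonneg _⟩ (⟨p, hp.1⟩ : K)
  have h1 := (norm_eq_iInf_iff_real_inner_le_zero hKcv hp.1).1 hinf y hl.1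
  have h2 := hl.2 p hp.1
  have h3 : ‖p - y‖ ^ 2 ≤ ⟪z - (y + l), p - y⟫ := by
    rw [← real_inner_self_eq_norm_sq]
    have e1 : ⟪z - (y + l), p - y⟫ = ⟪p - y, p - y⟫ - ⟪z - p, y - p⟫ - ⟪l, p - y⟫ := by
      have : z - (y + l) = (p - y) + (z - p) - l := by abel
      rw [this, inner_sub_left, inner_add_left]
      have : y - p = -(p - y) := by abel
      rw [this, inner_neg_right]; ring
    rw [e1]; linarith
  have h4 := real_inner_le_norm (z - (y + l)) (p - y)
  by_contra hcon
  push Not at hcon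
  have : 0 ≤ ‖z - (y + l)‖ := norm_nonneg _
  nlinarith


/-- the adjoint as a continuous linear map -/
def adjL (E F : Type*) [NormedAddCommGroup E] [InnerProductSpace ℝ E] [FiniteDimensional ℝ E]
    [NormedAddCommGroup F] [InnerProductSpace ℝ F] [FiniteDimensional ℝ F] :
    (E →L[ℝ] F) →L[ℝ] (F →L[ℝ] E) :=
  LinearMap.mkContinuous
    { toFun := fun T => ContinuousLinearMap.adjoint T
      map_add' := fun S T => map_add _ S T
      map_smul' := fun c T => by
        refine ContinuousLinearMap.ext fun z => ext_inner_right ℝ fun w => ?_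
        simp [ContinuousLinearMap.adjoint_inner_left, inner_smul_left] } 1
    (fun T => by simp)

lemma adjL_apply {E F : Type*} [NormedAddCommGroup E] [InnerProductSpace ℝ E]
    [FiniteDimensional ℝ E]
    [NormedAddCommGroup F] [InnerProductSpace ℝ F] [FiniteDimensional ℝ F] (T : E →L[ℝ] F) :
    adjL E F T = ContinuousLinearMap.adjoint T := rfl

lemma aux_grad {Z : Type*} [NormedAddCommGroup Z] [InnerProductSpace ℝ Z]
    [FiniteDimensional ℝ Z] (B : Y →L[ℝ] Y →L[ℝ] Z) (hB : ∀ v w, B v w = B w v) (μ : Z) (h : Y) :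
    (1 / 2 : ℝ) • gradient (fun h : Y => ⟪μ, B h h⟫) h = ContinuousLinearMap.adjoint (B h) μ := by
  have h1 : HasFDerivAt (fun h : Y => B h h) ((B h).comp (ContinuousLinearMap.id ℝ Y) +
      (B.flip h)) h := by
    have := B.hasFDerivAt (x := h)
    have h2 := this.clm_apply (hasFDerivAt_id h)
    exact h2
  have h2 : HasGradientAt (fun h : Y => ⟪μ, B h h⟫)
      ((2 : ℝ) • ContinuousLinearMap.adjoint (B h) μ) h := by
    rw [hasGradientAt_iff_hasFDerivAt]
    have h3 := (hasFDerivAt_const μ h).inner ℝ h1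
    refine h3.congr_fderiv ?_
    ext w
    simp [hB w h, inner_add_right, inner_smul_left, ContinuousLinearMap.adjoint_inner_left]
    ring
  rw [h2.gradient, smul_smul]
  norm_num

lemma aux_ri {N : Set Y} (h0 : (0 : Y) ∈ N) {l : Y} (hl : l ∈ intrinsicInterior ℝ N) :
    ∃ ρ : ℝ, 0 < ρ ∧ ∀ w ∈ Submodule.span ℝ N, ‖w‖ ≤ ρ → l + w ∈ N := by
  obtain ⟨y, hy, rfl⟩ := mem_intrinsicInterior.1 hl
  obtain ⟨ε, hε, hb⟩ := Metric.mem_nhds_iff.1 (mem_interior_iff_mem_nhds.1 hy)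
  refine ⟨ε / 2, by positivity, fun w hw hwn => ?_⟩
  have hd : w ∈ (affineSpan ℝ N).direction := by
    rw [direction_affineSpan, vectorSpan_eq_span_vsub_set_right ℝ h0]
    simpa using hw
  have hm : w +ᵥ (y : Y) ∈ affineSpan ℝ N := AffineSubspace.vadd_mem_of_mem_direction hd y.2
  have : (⟨w +ᵥ (y : Y), hm⟩ : affineSpan ℝ N) ∈ ball y ε := by
    rw [mem_ball, Subtype.dist_eq, dist_eq_norm]
    simp only [vadd_eq_add, add_sub_cancel_right]
    linarith
  have := hb this
  simp only [mem_preimage, vadd_eq_add] at this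
  rwa [add_comm]

lemma aux_reg {N : Set Y} (hcv : Convex ℝ N) (B : Y →L[ℝ] X) {l : Y} (hl : l ∈ N) {ρ : ℝ}
    (hρ : 0 < ρ) (hρN : ∀ w ∈ Submodule.span ℝ N, ‖w‖ ≤ ρ → l + w ∈ N) :
    ∃ C : ℝ, 0 ≤ C ∧ ∀ l1 ∈ N, ∃ l2 ∈ N, B l2 = B l ∧
      ‖l1 - l2‖ ≤ C * (1 + ‖l1 - l‖) * ‖B l1 - B l‖ := by
  let V := Submodule.span ℝ N
  let BV : V →ₗ[ℝ] X := (B : Y →ₗ[ℝ] X).domRestrict V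
  obtain ⟨R, hR⟩ := BV.rangeRestrict.exists_rightInverse_of_surjective BV.range_rangeRestrict
  let R' := LinearMap.toContinuousLinearMap R
  refine ⟨‖R'‖ * (1 + 1 / ρ), by positivity, fun l1 hl1 => ?_⟩
  have hd : l1 - l ∈ V := V.sub_mem (Submodule.subset_span hl1) (Submodule.subset_span hl)
  let r : LinearMap.range BV := BV.rangeRestrict ⟨l1 - l, hd⟩
  let v : V := R r
  have hrn : ‖r‖ = ‖B l1 - B l‖ := by
    rw [← map_sub]; rfl
  have hvn : ‖(v : Y)‖ ≤ ‖R'‖ * ‖B l1 - B l‖ := by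
    rw [← hrn]
    exact R'.le_opNorm r
  have hBv : B v = B l1 - B l := by
    have : BV.rangeRestrict v = r := by
      exact LinearMap.congr_fun hR r
    have := congrArg Subtype.val this
    rw [← map_sub]; exact this
  by_cases hv : (v : Y) = 0
  · refine ⟨l1, hl1, ?_, by simp; positivity⟩
    rw [hv, map_zero] at hBv
    exact (sub_eq_zero.1 hBv.symm)
  have hvpos : 0 < ‖(v : Y)‖ := norm_pos_iff.2 hv
  set τ : ℝ := ‖(v : Y)‖ / ρ with hτ
  have hτpos : 0 < τ := by positivity
  have hm : l - τ⁻¹ • (v : Y) ∈ N := by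
    rw [sub_eq_add_neg]
    refine hρN _ (V.neg_mem (V.smul_mem _ v.2)) ?_
    rw [norm_neg, norm_smul, norm_inv, Real.norm_of_nonneg hτpos.le, hτ]
    field_simp
    rfl
  refine ⟨(1 + τ)⁻¹ • l1 + (τ * (1 + τ)⁻¹) • (l - τ⁻¹ • (v : Y)),
    hcv hl1 hm (by positivity) (by positivity) (by field_simp), ?_, ?_⟩
  · simp only [map_add, map_smul, map_sub, hBv]
    rw [← sub_eq_zero]
    have : (1 + τ) ≠ 0 := by positivity
    match_scalars <;> field_simp <;> ring
  · have e : l1 - ((1 + τ)⁻¹ • l1 + (τ * (1 + τ)⁻¹) • (l - τ⁻¹ • (v : Y))) =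
        (1 + τ)⁻¹ • (τ • (l1 - l) + (v : Y)) := by
      match_scalars <;> field_simp <;> ring
    rw [e, norm_smul, norm_inv, Real.norm_of_nonneg (by positivity)]
    have h1 : (1 + τ)⁻¹ ≤ 1 := inv_le_one_of_one_le₀ (by linarith)
    calc (1 + τ)⁻¹ * ‖τ • (l1 - l) + (v : Y)‖ ≤ 1 * (‖τ • (l1 - l)‖ + ‖(v : Y)‖) := by
          gcongr; exact norm_add_le _ _
      _ = ‖(v : Y)‖ * (1 / ρ * ‖l1 - l‖ + 1) := by
          rw [norm_smul, Real.norm_of_nonneg hτpos.le, hτ]; ring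
      _ ≤ (‖R'‖ * ‖B l1 - B l‖) * ((1 + 1 / ρ) * (1 + ‖l1 - l‖)) := by
          gcongr
          have : 0 ≤ ‖l1 - l‖ := norm_nonneg _
          have : 0 ≤ 1 / ρ := by positivity
          nlinarith
      _ = _ := by ring


lemma aux_lim {E F : Type*} [NormedAddCommGroup E] [NormedSpace ℝ E]
    [NormedAddCommGroup F] [NormedSpace ℝ F] {φ : E → F} {φ' : E →L[ℝ] F} {y : E}
    (hφ : HasFDerivAt φ φ' y) {t : ℕ → ℝ} {z : ℕ → E} {w : E}
    (hz : Tendsto z atTop (𝓝 y)) (hw : Tendsto (fun n => (t n)⁻¹ • (z n - y)) atTop (𝓝 w)) :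
    Tendsto (fun n => (t n)⁻¹ • (φ (z n) - φ y)) atTop (𝓝 (φ' w)) := by
  have h := (hasFDerivWithinAt_univ.2 hφ).lim (l := atTop) (c := fun n => (t n)⁻¹)
    (d := fun n => z n - y) (v := w) (by simpa using hz.sub_const y)
    (.of_forall fun _ ↦ mem_univ _) hw
  simpa using h

lemma aux_tan {Z : Type*} [NormedAddCommGroup Z] [InnerProductSpace ℝ Z]
    {K U : Set Y} {D : Set Z} {Ξ : Y → Z}
    (hD : PointedClosedConvexCone D)
    (hU : IsOpen U) (hred : K ∩ U = {y ∈ U | Ξ y ∈ D}) {y : Y} (hyU : y ∈ U) (hΞ0 : Ξ y = 0)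
    {T : Y →L[ℝ] Z} (hT : HasFDerivAt Ξ T y) {h : Y} (hh : h ∈ contCone K y) : T h ∈ D := by
  obtain ⟨t, v, ht, ht0, hv, hK⟩ := hh
  have hz : Tendsto (fun n => y + t n • v n) atTop (𝓝 y) := by
    simpa using (ht0.smul hv).const_add y
  have hlim : Tendsto (fun n => (t n)⁻¹ • (Ξ (y + t n • v n) - Ξ y)) atTop (𝓝 (T h)) := by
    refine aux_lim hT hz ?_
    refine hv.congr fun n => ?_
    rw [add_sub_cancel_left, smul_smul, inv_mul_cancel₀ (ht n).ne', one_smul]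
  refine hD.1.mem_of_tendsto hlim ?_
  filter_upwards [hz (hU.mem_nhds hyU)] with n hn
  rw [hΞ0, sub_zero]
  refine hD.2.2.1 _ (inv_nonneg.2 (ht n).le) _ ?_
  have : y + t n • v n ∈ K ∩ U := ⟨hK n, hn⟩
  rw [hred] at this; exact this.2

lemma aux_dirderiv {Z : Type*} [NormedAddCommGroup Z] [InnerProductSpace ℝ Z]
    [FiniteDimensional ℝ Z] {K U : Set Y} {D : Set Z} {Ξ : Y → Z}
    (hKcl : IsClosed K) (hKcv : Convex ℝ K) (hD : PointedClosedConvexCone D)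
    (hU : IsOpen U) (hred : K ∩ U = {y ∈ U | Ξ y ∈ D}) {y0 : Y} (hyU : y0 ∈ U)
    (hΞ0 : Ξ y0 = 0) (hΞ : ContDiffOn ℝ 2 Ξ U)
    (hsurj : Function.Surjective (fderiv ℝ Ξ y0)) {l0 : Y} {μ : Z} (hμ : μ ∈ nCone D (Ξ y0))
    (hlμ : l0 = ContinuousLinearMap.adjoint (fderiv ℝ Ξ y0) μ)
    {h : Y} (hh : h ∈ criticalCone K y0 l0) {n : Y} (hn : n ∈ nCone K y0) (σ : ℝ)
    (hort : ⟪n + σ • l0, h⟫ = 0) :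
    HasDirDeriv (projK K) (y0 + l0)
      (h + (n + σ • l0 + ContinuousLinearMap.adjoint (fderiv ℝ (fderiv ℝ Ξ) y0 h) μ)) h := by
  have hcd : ∀ y ∈ U, ContDiffAt ℝ 2 Ξ y := fun y hy => hΞ.contDiffAt (hU.mem_nhds hy)
  have hT : HasStrictFDerivAt Ξ (fderiv ℝ Ξ y0) y0 := (hcd y0 hyU).hasStrictFDerivAt (by norm_num)
  have hT2 : HasFDerivAt (fderiv ℝ Ξ) (fderiv ℝ (fderiv ℝ Ξ) y0) y0 :=
    (((hcd y0 hyU).fderiv_right (m := 1) (by norm_num)).differentiableAt (by norm_num)).hasFDerivAt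
  obtain ⟨n', hn', hnn'⟩ := aux_push hD.2.1 hU hred hn.1 hyU hT hsurj hn
  set T := fderiv ℝ Ξ y0
  have hd : T h ∈ D := aux_tan hD hU hred hyU hΞ0 hT.hasFDerivAt hh.1
  obtain ⟨c, hc0, hc, hcev⟩ := aux_curve hT hsurj h
  set ν : Z := n' + σ • μ with hν
  have hζ : ContinuousLinearMap.adjoint T ν = n + σ • l0 := by
    rw [hν, map_add, map_smul, ← hnn', ← hlμ]
  have hμd : ⟪μ, T h⟫ = 0 := by
    rw [← ContinuousLinearMap.adjoint_inner_left, ← hlμ]; exact hh.2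
  have hνd : ⟪ν, T h⟫ = 0 := by
    rw [← ContinuousLinearMap.adjoint_inner_left, hζ]; exact hort
  let q : ℝ → Y := fun s => c s + adjL Y Z (fderiv ℝ Ξ (c s)) (μ + s • ν)
  set w : Y := h + (n + σ • l0 + ContinuousLinearMap.adjoint (fderiv ℝ (fderiv ℝ Ξ) y0 h) μ) with hw
  have hq0 : q 0 = y0 + l0 := by
    simp only [q, hc0, zero_smul, add_zero, adjL_apply]
    rw [hlμ]
  have hq : HasDerivAt q w 0 := by
    have h1 : HasDerivAt (fun s => fderiv ℝ Ξ (c s)) (fderiv ℝ (fderiv ℝ Ξ) y0 h) 0 := by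
      refine HasFDerivAt.comp_hasDerivAt (l := fderiv ℝ Ξ) 0 ?_ hc
      rw [hc0]; exact hT2
    have h2 : HasDerivAt (fun s => adjL Y Z (fderiv ℝ Ξ (c s)))
        (adjL Y Z (fderiv ℝ (fderiv ℝ Ξ) y0 h)) 0 :=
      (adjL Y Z).hasFDerivAt.comp_hasDerivAt 0 h1
    have h3 : HasDerivAt (fun s : ℝ => μ + s • ν) ν 0 := by
      simpa using ((hasDerivAt_id (0 : ℝ)).smul_const ν).const_add μ
    have h4 := hc.add (h2.clm_apply h3)
    have e : h + (adjL Y Z (fderiv ℝ (fderiv ℝ Ξ) y0 h) (μ + (0 : ℝ) • ν) +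
        adjL Y Z (fderiv ℝ Ξ (c 0)) ν) = w := by
      simp only [adjL_apply, zero_smul, add_zero, hc0]
      rw [hw, ← hζ]
      congr 1
      rw [add_comm]
    rw [e] at h4
    exact h4
  have hproj0 : projK K (y0 + l0) = y0 := by
    have hl0 : l0 ∈ nCone K y0 := by
      rw [hlμ]; exact aux_pull hKcv hU hred hn.1 hyU hT.hasFDerivAt hμ
    have := aux_proj hKcl hKcv hl0 (y0 + l0)
    rw [sub_self, norm_zero] at this
    exact sub_eq_zero.1 (norm_le_zero_iff.1 this)
  have hbd : ∀ᶠ s in 𝓝[>] (0 : ℝ),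
      ‖projK K (y0 + l0 + s • w) - c s‖ ≤ ‖y0 + l0 + s • w - q s‖ := by
    have hnU : ∀ᶠ s in 𝓝 (0 : ℝ), c s ∈ U :=
      hc.continuousAt (hU.mem_nhds (by simpa [hc0] using hyU))
    have hsm : ∀ᶠ s in 𝓝 (0 : ℝ), 0 < 1 + s * σ := by
      have : Tendsto (fun s : ℝ => 1 + s * σ) (𝓝 0) (𝓝 (1 + 0 * σ)) :=
        (Continuous.tendsto (by fun_prop) 0)
      exact this.eventually (lt_mem_nhds (by norm_num))
    filter_upwards [self_mem_nhdsWithin, nhdsWithin_le_nhds hnU, nhdsWithin_le_nhds hsm,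
      nhdsWithin_le_nhds hcev] with s hs hsU hs1 hsc
    have hs0 : (0 : ℝ) < s := hs
    rw [hΞ0, zero_add] at hsc
    have hDm : s • T h ∈ D := hD.2.2.1 s hs0.le _ hd
    have hK : c s ∈ K := by
      have : c s ∈ K ∩ U := by rw [hred]; exact ⟨hsU, by rw [hsc]; exact hDm⟩
      exact this.1
    refine aux_proj hKcl hKcv ?_ _
    rw [adjL_apply]
    refine aux_pull hKcv hU hred hK hsU
      (((hcd _ hsU).differentiableAt (by norm_num)).hasFDerivAt) ?_
    rw [hsc]
    refine ⟨hDm, fun z hz => ?_⟩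
    have e1 : ⟪μ, z⟫ ≤ 0 := by
      have := hμ.2 z hz; rwa [hΞ0, sub_zero] at this
    have e2 : ⟪n', z⟫ ≤ 0 := by
      have := hn'.2 z hz; rwa [hΞ0, sub_zero] at this
    have e3 : ⟪μ + s • ν, z - s • T h⟫ = (1 + s * σ) * ⟪μ, z⟫ + s * ⟪n', z⟫ := by
      rw [inner_sub_right, inner_smul_right, inner_add_left (x := μ) (z := T h), hμd,
        real_inner_smul_left (x := ν) (y := T h), hνd, hν]
      simp only [inner_add_left, real_inner_smul_left, smul_add]
      ring
    rw [e3]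
    have := mul_nonpos_of_nonneg_of_nonpos hs1.le e1
    have := mul_nonpos_of_nonneg_of_nonpos hs0.le e2
    linarith
  unfold HasDirDeriv
  rw [hproj0]
  have hA : Tendsto (fun s : ℝ => s⁻¹ • (projK K (y0 + l0 + s • w) - c s)) (𝓝[>] 0) (𝓝 0) := by
    have hB : Tendsto (fun s : ℝ => ‖w - s⁻¹ • (q (0 + s) - q 0)‖) (𝓝[>] 0) (𝓝 0) := by
      simpa using (hq.tendsto_slope_zero_right.const_sub w).norm
    refine squeeze_zero_norm' ?_ hB
    filter_upwards [hbd, self_mem_nhdsWithin] with s hs hs0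
    have hs0' : (0 : ℝ) < s := hs0
    have e : w - s⁻¹ • (q (0 + s) - q 0) = s⁻¹ • (y0 + l0 + s • w - q s) := by
      rw [zero_add, hq0, smul_sub, smul_sub, smul_add s⁻¹ (y0 + l0), smul_smul,
        inv_mul_cancel₀ hs0'.ne', one_smul]
      abel
    rw [e, norm_smul, norm_smul]
    gcongr
  have hC := hc.tendsto_slope_zero_right
  have := hA.add hC
  rw [zero_add] at this
  refine this.congr fun s => ?_
  rw [zero_add, hc0, ← smul_add]
  congr 1; abel

lemma aux_mult {Z : Type*} [NormedAddCommGroup Z] [InnerProductSpace ℝ Z]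
    [FiniteDimensional ℝ Z] {K U : Set Y} {D : Set Z} {Ξ : Y → Z}
    (hD : PointedClosedConvexCone D)
    (hU : IsOpen U) (hred : K ∩ U = {y ∈ U | Ξ y ∈ D}) {y0 : Y} (hyU : y0 ∈ U)
    (hΞ : ContDiffOn ℝ 2 Ξ U)
    (hsurj : Function.Surjective (fderiv ℝ Ξ y0)) :
    ∃ C : ℝ, 0 ≤ C ∧ ∀ᶠ y in 𝓝 y0, ∀ l ∈ nCone K y, ∃ ν ∈ nCone D 0,
      l = ContinuousLinearMap.adjoint (fderiv ℝ Ξ y) ν ∧ ‖ν‖ ≤ C * ‖l‖ ∧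
      ∀ μ0 : Z, ‖ν - μ0‖ ≤ C * (‖l - ContinuousLinearMap.adjoint (fderiv ℝ Ξ y0) μ0‖ +
        ‖fderiv ℝ Ξ y - fderiv ℝ Ξ y0‖ * ‖l‖) := by
  have hcd : ∀ y ∈ U, ContDiffAt ℝ 2 Ξ y := fun y hy => hΞ.contDiffAt (hU.mem_nhds hy)
  have hcont : ContinuousAt (fderiv ℝ Ξ) y0 :=
    ((hcd y0 hyU).fderiv_right (m := 1) (by norm_num)).continuousAt
  obtain ⟨R, hR⟩ := ContinuousLinearMap.exists_rightInverse_of_surjective (fderiv ℝ Ξ y0)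
    (LinearMap.range_eq_top.mpr hsurj)
  have hRz : ∀ z, fderiv ℝ Ξ y0 (R z) = z := fun z => by
    have := congrArg (fun T : Z →L[ℝ] Z => T z) hR
    simpa using this
  set T0 := fderiv ℝ Ξ y0
  have hnear : ∀ᶠ y in 𝓝 y0, ‖fderiv ℝ Ξ y - T0‖ * ‖R‖ ≤ 1 / 2 := by
    have : Tendsto (fun y => ‖fderiv ℝ Ξ y - T0‖ * ‖R‖) (𝓝 y0) (𝓝 0) := by
      have h1 := (hcont.tendsto.sub_const T0).norm.mul_const ‖R‖
      have e : ‖fderiv ℝ Ξ y0 - T0‖ * ‖R‖ = 0 := by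
        rw [show fderiv ℝ Ξ y0 - T0 = 0 from sub_self _, norm_zero, zero_mul]
      rwa [e] at h1
    exact (this.eventually (gt_mem_nhds (by norm_num : (0 : ℝ) < 1 / 2))).mono fun y hy => hy.le
  refine ⟨3 * ‖R‖ + 2 * ‖R‖ ^ 2, by positivity, ?_⟩
  filter_upwards [hnear, hU.mem_nhds hyU] with y hy hyU' l hl
  set T := fderiv ℝ Ξ y
  have hTs : Function.Surjective T := by
    have hinj : Function.Injective ((T.comp R : Z →L[ℝ] Z) : Z →ₗ[ℝ] Z) := by
      rw [injective_iff_map_eq_zero]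
      intro z hz
      have hz' : T (R z) = 0 := hz
      have h1 : ‖(T - T0) (R z)‖ ≤ ‖T - T0‖ * (‖R‖ * ‖z‖) :=
        ((T - T0).le_opNorm _).trans (by gcongr; exact R.le_opNorm z)
      rw [sub_apply, hz', hRz, zero_sub, norm_neg] at h1
      have h2 : ‖z‖ ≤ 1 / 2 * ‖z‖ := by
        calc ‖z‖ ≤ _ := h1
          _ = (‖T - T0‖ * ‖R‖) * ‖z‖ := by ring
          _ ≤ _ := by gcongr
      exact norm_le_zero_iff.1 (by linarith)
    have hsu := LinearMap.injective_iff_surjective.1 hinj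
    intro z
    obtain ⟨u, hu⟩ := hsu z
    exact ⟨R u, hu⟩
  obtain ⟨ν, hν, hlν⟩ := aux_push hD.2.1 hU hred hl.1 hyU'
    ((hcd y hyU').hasStrictFDerivAt (by norm_num)) hTs hl
  have hgen : ∀ μ0 : Z, ‖ν - μ0‖ ≤ ‖R‖ * (‖T - T0‖ * ‖ν‖ +
      ‖l - ContinuousLinearMap.adjoint T0 μ0‖) := by
    intro μ0
    have e : ν - μ0 = ContinuousLinearMap.adjoint R
        (-(ContinuousLinearMap.adjoint (T - T0) ν) + (l - ContinuousLinearMap.adjoint T0 μ0)) := by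
      refine ext_inner_right ℝ fun z => ?_
      rw [hlν]
      simp only [ContinuousLinearMap.adjoint_inner_left, inner_sub_left, inner_add_left,
        inner_neg_left, sub_apply, inner_sub_right, hRz]
      ring
    rw [e]
    refine (ContinuousLinearMap.le_opNorm _ _).trans ?_
    rw [LinearIsometryEquiv.norm_map]
    gcongr
    refine (norm_add_le _ _).trans ?_
    rw [norm_neg]
    gcongr
    refine (ContinuousLinearMap.le_opNorm _ _).trans ?_
    rw [LinearIsometryEquiv.norm_map]
  have hνb : ‖ν‖ ≤ 2 * ‖R‖ * ‖l‖ := by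
    have := hgen 0
    simp only [sub_zero, map_zero] at this
    have h2 : ‖R‖ * (‖T - T0‖ * ‖ν‖ + ‖l‖) ≤ 1 / 2 * ‖ν‖ + ‖R‖ * ‖l‖ := by
      calc _ = (‖T - T0‖ * ‖R‖) * ‖ν‖ + ‖R‖ * ‖l‖ := by ring
        _ ≤ _ := by gcongr
    linarith
  refine ⟨ν, (aux_cone_normal hD hν).2, hlν, ?_, fun μ0 => (hgen μ0).trans ?_⟩
  · refine hνb.trans ?_
    gcongr
    nlinarith [norm_nonneg R]
  · have : ‖T - T0‖ * ‖ν‖ ≤ ‖T - T0‖ * (2 * ‖R‖ * ‖l‖) := by gcongr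
    have h3 : ‖R‖ * (‖T - T0‖ * ‖ν‖) ≤ ‖R‖ * (‖T - T0‖ * (2 * ‖R‖ * ‖l‖)) := by gcongr
    have h4 : 0 ≤ ‖R‖ * ‖l - ContinuousLinearMap.adjoint T0 μ0‖ := by positivity
    have h5 : 0 ≤ ‖R‖ ^ 2 * ‖l - ContinuousLinearMap.adjoint T0 μ0‖ := by positivity
    have h6 : 0 ≤ ‖R‖ * (‖T - T0‖ * ‖l‖) := by positivity
    nlinarith


lemma aux_tapply {E F : Type*} [NormedAddCommGroup E] [NormedSpace ℝ E]
    [NormedAddCommGroup F] [NormedSpace ℝ F] {T : ℕ → E →L[ℝ] F} {T0 : E →L[ℝ] F} {v : ℕ → E}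
    {v0 : E} (hT : Tendsto T atTop (𝓝 T0)) (hv : Tendsto v atTop (𝓝 v0)) :
    Tendsto (fun n => T n (v n)) atTop (𝓝 (T0 v0)) :=
  ((isBoundedBilinearMap_apply (𝕜 := ℝ) (E := E) (F := F)).continuous.tendsto (T0, v0)).comp
    (hT.prodMk_nhds hv)

lemma aux_gradf (f : X → ℝ) (u : X) : gradient f u = adjL X ℝ (fderiv ℝ f u) 1 := by
  refine ext_inner_right ℝ fun w => ?_
  rw [adjL_apply, ContinuousLinearMap.adjoint_inner_left]
  simp [gradient, InnerProductSpace.toDual_symm_apply]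

lemma aux_lag {f : X → ℝ} {g : X → Y} (hf : Differentiable ℝ f) (hg : Differentiable ℝ g)
    (l : Y) (u : X) : gradient (fun v => f v + ⟪l, g v⟫) u =
      gradient f u + adjL X Y (fderiv ℝ g u) l := by
  refine HasGradientAt.gradient ?_
  rw [hasGradientAt_iff_hasFDerivAt]
  have h3 := (hf u).hasFDerivAt.add ((hasFDerivAt_const l u).inner ℝ (hg u).hasFDerivAt)
  refine h3.congr_fderiv ?_
  ext w
  rw [aux_gradf]
  simp [adjL_apply, inner_add_left, ContinuousLinearMap.adjoint_inner_left]

lemma aux_difffd {E F : Type*} [NormedAddCommGroup E] [NormedSpace ℝ E]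
    [NormedAddCommGroup F] [NormedSpace ℝ F] {f : E → F} (hf : ContDiff ℝ 2 f) :
    Differentiable ℝ (fderiv ℝ f) :=
  (hf.fderiv_right (m := 1) (by norm_num)).differentiable (by norm_num)

lemma aux_diffgrad {f : X → ℝ} (hf : ContDiff ℝ 2 f) : Differentiable ℝ (gradient f) := by
  have e : gradient f = fun u => adjL X ℝ (fderiv ℝ f u) 1 := funext fun u => aux_gradf f u
  rw [e]
  intro u
  exact ((adjL X ℝ).differentiableAt.comp u (aux_difffd hf u)).clm_apply
    (differentiableAt_const _)

lemma aux_diffadj {g : X → Y} (hg : ContDiff ℝ 2 g) :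
    Differentiable ℝ (fun u => adjL X Y (fderiv ℝ g u)) := fun u =>
  (adjL X Y).differentiableAt.comp u (aux_difffd hg u)

lemma aux_hess {f : X → ℝ} {g : X → Y} (hf : ContDiff ℝ 2 f) (hg : ContDiff ℝ 2 g) (x0 : X)
    (l0 : Y) : HasFDerivAt (fun u => gradient f u + adjL X Y (fderiv ℝ g u) l0)
      (hessLxx f g x0 l0) x0 := by
  have e : (fun u => gradient (fun v => f v + ⟪l0, g v⟫) u) =
      fun u => gradient f u + adjL X Y (fderiv ℝ g u) l0 :=
    funext fun u => aux_lag (hf.differentiable (by norm_num)) (hg.differentiable (by norm_num)) l0 u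
  unfold hessLxx
  rw [e]
  exact ((aux_diffgrad hf x0).add
    ((aux_diffadj hg x0).clm_apply (differentiableAt_const _))).hasFDerivAt

lemma aux_ncone {K : Set Y} {y : Y} (hy : y ∈ K) : (0 : Y) ∈ nCone K y ∧ Convex ℝ (nCone K y) ∧
    ∀ t : ℝ, 0 ≤ t → ∀ l ∈ nCone K y, t • l ∈ nCone K y := by
  refine ⟨⟨hy, by simp⟩, ?_, ?_⟩
  · intro l hl l' hl' a b ha hb _
    refine ⟨hy, fun k hk => ?_⟩
    rw [inner_add_left, real_inner_smul_left, real_inner_smul_left]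
    have := mul_nonpos_of_nonneg_of_nonpos ha (hl.2 k hk)
    have := mul_nonpos_of_nonneg_of_nonpos hb (hl'.2 k hk)
    linarith
  · intro t ht l hl
    refine ⟨hy, fun k hk => ?_⟩
    rw [real_inner_smul_left]
    exact mul_nonpos_of_nonneg_of_nonpos ht (hl.2 k hk)

lemma aux_core {f : X → ℝ} {g : X → Y} {K : Set Y}
    (hf : ContDiff ℝ 2 f) (hg : ContDiff ℝ 2 g) (hKcl : IsClosed K) (hKcv : Convex ℝ K)
    {x0 : X} {l0 : Y} (hKKT : (x0, l0) ∈ sKKT f g K 0 0)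
    {m : ℕ} {U : Set Y} {D : Set (EuclideanSpace ℝ (Fin m))}
    {Ξ : Y → EuclideanSpace ℝ (Fin m)}
    (hU : IsOpen U) (hyU : g x0 ∈ U) (hD : PointedClosedConvexCone D)
    (hΞ : ContDiffOn ℝ 2 Ξ U) (hΞ0 : Ξ (g x0) = 0)
    (hsurj : Function.Surjective (fderiv ℝ Ξ (g x0)))
    (hredU : K ∩ U = {y ∈ U | Ξ y ∈ D})
    {μ : EuclideanSpace ℝ (Fin m)} (hμ : μ ∈ nCone D (Ξ (g x0)))
    (hlμ : l0 = ContinuousLinearMap.adjoint (fderiv ℝ Ξ (g x0)) μ)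
    (hpos : ∀ (ξ : X) (ζ : Y),
      hessLxx f g x0 l0 ξ + ContinuousLinearMap.adjoint (fderiv ℝ g x0)
          (ζ + (1 / 2 : ℝ) •
            gradient (fun h : Y => ⟪μ, fderiv ℝ (fderiv ℝ Ξ) (g x0) h h⟫)
              (fderiv ℝ g x0 ξ)) = 0 →
      fderiv ℝ g x0 ξ ∈ criticalCone K (g x0) l0 →
      ContinuousLinearMap.adjoint (fderiv ℝ g x0) ζ ∈
        ContinuousLinearMap.adjoint (fderiv ℝ g x0) ''
          (nCone K (g x0) + Set.range fun t : ℝ => t • l0) →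
      0 ≤ ⟪fderiv ℝ g x0 ξ, ζ⟫)
    (hri : (intrinsicInterior ℝ (nCone K (g x0)) ∩ mSet f g K x0 0 0).Nonempty)
    (hnc : Noncritical f g K x0 l0)
    {x a : ℕ → X} {l b : ℕ → Y} {t : ℕ → ℝ} {ξ : X} (ht : ∀ n, 0 < t n)
    (ht0 : Tendsto t atTop (𝓝 0))
    (hξ : Tendsto (fun n => (t n)⁻¹ • (x n - x0)) atTop (𝓝 ξ))
    (ha : Tendsto (fun n => (t n)⁻¹ • a n) atTop (𝓝 0))
    (hb : Tendsto (fun n => (t n)⁻¹ • b n) atTop (𝓝 0))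
    (hl : Tendsto l atTop (𝓝 l0))
    (hk : ∀ n, (x n, l n) ∈ sKKT f g K (a n) (b n)) : ξ = 0 := by
  obtain ⟨hst0, hl0⟩ := hKKT
  simp only [sub_zero] at hst0 hl0
  obtain ⟨lh, hlri, hlM⟩ := hri
  obtain ⟨hsth, hlhN⟩ := hlM
  simp only [sub_zero] at hsth hlhN
  have hAll : ContinuousLinearMap.adjoint (fderiv ℝ g x0) lh =
      ContinuousLinearMap.adjoint (fderiv ℝ g x0) l0 := by
    have := hsth.trans hst0.symm
    exact add_left_cancel this
  have hcd : ContDiffAt ℝ 2 Ξ (g x0) := hΞ.contDiffAt (hU.mem_nhds hyU)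
  have hT : HasFDerivAt Ξ (fderiv ℝ Ξ (g x0)) (g x0) :=
    (hcd.differentiableAt (by norm_num)).hasFDerivAt
  have hT2 : HasFDerivAt (fderiv ℝ Ξ) (fderiv ℝ (fderiv ℝ Ξ) (g x0)) (g x0) :=
    ((hcd.fderiv_right (m := 1) (by norm_num)).differentiableAt (by norm_num)).hasFDerivAt
  obtain ⟨C, hC, hmult⟩ := aux_mult hD hU hredU hyU hΞ hsurj
  set y0 := g x0 with hy0
  set A := fderiv ℝ g x0 with hA
  set N := nCone K y0 with hN
  obtain ⟨h0N, hNcv, hNsm⟩ := aux_ncone hl0.1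
  obtain ⟨ρ, hρ, hρN⟩ := aux_ri h0N hlri
  -- convergence
  have hx : Tendsto x atTop (𝓝 x0) := by
    have h1 : Tendsto (fun n => x n - x0) atTop (𝓝 0) := by
      have := ht0.smul hξ
      rw [zero_smul] at this
      refine this.congr fun n => ?_
      rw [smul_smul, mul_inv_cancel₀ (ht n).ne', one_smul]
    simpa using h1.add_const x0
  have hb0 : Tendsto b atTop (𝓝 0) := by
    have := ht0.smul hb
    rw [zero_smul] at this
    refine this.congr fun n => ?_
    rw [smul_smul, mul_inv_cancel₀ (ht n).ne', one_smul]
  set y : ℕ → Y := fun n => g (x n) - b n with hy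
  have hgx : Tendsto (fun n => g (x n)) atTop (𝓝 y0) :=
    (hg.continuous.tendsto x0).comp hx
  have hyt : Tendsto y atTop (𝓝 y0) := by simpa using hgx.sub hb0
  have hgd : HasFDerivAt g A x0 := ((hg.differentiable (by norm_num)) x0).hasFDerivAt
  set h := A ξ with hh
  have hyh : Tendsto (fun n => (t n)⁻¹ • (y n - y0)) atTop (𝓝 h) := by
    have h1 := (aux_lim hgd hx hξ).sub hb
    rw [sub_zero] at h1
    refine h1.congr fun n => ?_
    rw [← smul_sub]; congr 1; simp only [hy]; abel
  have hyK : ∀ n, y n ∈ K := fun n => (hk n).2.1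
  -- first-order facts
  have hNh : ∀ p ∈ N, ⟪p, h⟫ ≤ 0 := by
    intro p hp
    refine le_of_tendsto ((tendsto_const_nhds (x := p)).inner hyh) (.of_forall fun n => ?_)
    rw [real_inner_smul_right]
    exact mul_nonpos_of_nonneg_of_nonpos (inv_nonneg.2 (ht n).le) (hp.2 _ (hyK n))
  have hl0h : ⟪l0, h⟫ = 0 := by
    refine le_antisymm (hNh l0 hl0) ?_
    refine ge_of_tendsto (hl.inner hyh) (.of_forall fun n => ?_)
    rw [real_inner_smul_right]
    refine mul_nonneg (inv_nonneg.2 (ht n).le) ?_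
    have := (hk n).2.2 y0 hl0.1
    have e : y0 - (g (x n) - b n) = -(y n - y0) := by simp only [hy]; abel
    simp only at this
    rw [e, inner_neg_right] at this
    linarith
  have hcrit : h ∈ criticalCone K y0 l0 := by
    refine ⟨⟨t, fun n => (t n)⁻¹ • (y n - y0), ht, ht0, hyh, fun n => ?_⟩, hl0h⟩
    rw [smul_smul, mul_inv_cancel₀ (ht n).ne', one_smul]
    simpa using hyK n
  -- multipliers in the reduced space
  have hev := hyt.eventually hmult
  have hex : ∀ n, ∃ ν : EuclideanSpace ℝ (Fin m), (∀ p ∈ nCone K (y n), ∃ ν ∈ nCone D 0,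
      p = ContinuousLinearMap.adjoint (fderiv ℝ Ξ (y n)) ν ∧ ‖ν‖ ≤ C * ‖p‖ ∧
      ∀ μ0, ‖ν - μ0‖ ≤ C * (‖p - ContinuousLinearMap.adjoint (fderiv ℝ Ξ y0) μ0‖ +
        ‖fderiv ℝ Ξ (y n) - fderiv ℝ Ξ y0‖ * ‖p‖)) → (ν ∈ nCone D 0 ∧
      l n = ContinuousLinearMap.adjoint (fderiv ℝ Ξ (y n)) ν ∧
      ‖ν - μ‖ ≤ C * (‖l n - l0‖ + ‖fderiv ℝ Ξ (y n) - fderiv ℝ Ξ y0‖ * ‖l n‖)) := by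
    intro n
    by_cases hc : (∀ p ∈ nCone K (y n), ∃ ν ∈ nCone D 0,
      p = ContinuousLinearMap.adjoint (fderiv ℝ Ξ (y n)) ν ∧ ‖ν‖ ≤ C * ‖p‖ ∧
      ∀ μ0, ‖ν - μ0‖ ≤ C * (‖p - ContinuousLinearMap.adjoint (fderiv ℝ Ξ y0) μ0‖ +
        ‖fderiv ℝ Ξ (y n) - fderiv ℝ Ξ y0‖ * ‖p‖))
    · obtain ⟨ν, h1, h2, -, h3⟩ := hc (l n) (hk n).2
      refine ⟨ν, fun _ => ⟨h1, h2, ?_⟩⟩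
      have := h3 μ
      rwa [← hlμ] at this
    · exact ⟨0, fun h => absurd h hc⟩
  choose ν hν using hex
  have hev2 := hev.mono fun n hn => hν n hn
  have hνμ : Tendsto ν atTop (𝓝 μ) := by
    rw [tendsto_iff_norm_sub_tendsto_zero]
    have hTy : Tendsto (fun n => fderiv ℝ Ξ (y n)) atTop (𝓝 (fderiv ℝ Ξ y0)) :=
      hT2.continuousAt.tendsto.comp hyt
    have hlim : Tendsto (fun n => C * (‖l n - l0‖ +
        ‖fderiv ℝ Ξ (y n) - fderiv ℝ Ξ y0‖ * ‖l n‖)) atTop (𝓝 0) := by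
      have h1 := ((hl.sub_const l0).norm.add
        ((hTy.sub_const (fderiv ℝ Ξ y0)).norm.mul hl.norm)).const_mul C
      simpa using h1
    refine squeeze_zero' (.of_forall fun n => norm_nonneg _) ?_ hlim
    exact hev2.mono fun n hn => hn.2.2
  -- limit of the stationarity condition
  have hlim1 : Tendsto (fun n => (t n)⁻¹ • (adjL X Y A (l n - l0))) atTop
      (𝓝 (-(hessLxx f g x0 l0 ξ))) := by
    have h1 := aux_lim (aux_hess hf hg x0 l0) hx hξ
    have h2 := aux_lim (aux_diffadj hg x0).hasFDerivAt hx hξ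
    have h3 := aux_tapply h2 (hl.sub_const l0)
    rw [sub_self, map_zero] at h3
    have h4 := (ha.sub h1).sub h3
    rw [zero_sub, sub_zero] at h4
    refine h4.congr fun n => ?_
    have e := (hk n).1
    simp only at e
    rw [← e, ← adjL_apply]
    have e0 : gradient f x0 + adjL X Y A l0 = 0 := hst0
    rw [smul_apply, ← smul_sub, ← smul_sub, e0]
    congr 1
    simp only [sub_apply, map_sub]
    abel
  have hlim2 : Tendsto (fun n => (t n)⁻¹ • (adjL X Y A
      (ContinuousLinearMap.adjoint (fderiv ℝ Ξ y0) (ν n) - l0))) atTop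
      (𝓝 (-(hessLxx f g x0 l0 ξ) - adjL X Y A
        (ContinuousLinearMap.adjoint (fderiv ℝ (fderiv ℝ Ξ) y0 h) μ))) := by
    have hT3 : HasFDerivAt (fun u => adjL Y (EuclideanSpace ℝ (Fin m)) (fderiv ℝ Ξ u))
        ((adjL Y (EuclideanSpace ℝ (Fin m))).comp (fderiv ℝ (fderiv ℝ Ξ) y0)) y0 :=
      (adjL Y (EuclideanSpace ℝ (Fin m))).hasFDerivAt.comp y0 hT2
    have h1 := aux_tapply (aux_lim hT3 hyt hyh) hνμ
    have h2 := ((adjL X Y A).continuous.tendsto _).comp h1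
    have h3 := hlim1.sub h2
    refine Tendsto.congr' ?_ h3
    filter_upwards [hev2] with n hn
    have e := hn.2.1
    simp only [Function.comp, smul_apply, map_smul]
    rw [← smul_sub, ← map_sub, e]
    congr 2
    simp only [sub_apply, adjL_apply]
    abel
  set W : Submodule ℝ X := (Submodule.span ℝ N).map (adjL X Y A : Y →ₗ[ℝ] X) with hW
  have hWcl : IsClosed (W : Set X) := W.closed_of_finiteDimensional
  have hmem := hWcl.mem_of_tendsto hlim2 (by
    filter_upwards [hev2] with n hn
    refine W.smul_mem _ (Submodule.mem_map_of_mem (f := (adjL X Y A : Y →ₗ[ℝ] X)) ?_)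
    refine Submodule.sub_mem _ (Submodule.subset_span ?_) (Submodule.subset_span hl0)
    exact aux_pull hKcv hU hredU hl0.1 hyU hT (by rw [hΞ0]; exact hn.1))
  obtain ⟨w, hw, hwe⟩ := hmem
  have hwe' : adjL X Y A w = -(hessLxx f g x0 l0 ξ) - adjL X Y A
        (ContinuousLinearMap.adjoint (fderiv ℝ (fderiv ℝ Ξ) y0 h) μ) := hwe
  set s : ℝ := ρ / (‖w‖ + 1) with hs
  have hspos : 0 < s := by positivity
  have hsw : lh + s • w ∈ N := by
    refine hρN _ (Submodule.smul_mem _ _ hw) ?_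
    rw [norm_smul, Real.norm_of_nonneg hspos.le, hs, div_mul_eq_mul_div, div_le_iff₀ (by positivity)]
    nlinarith [norm_nonneg w]
  set p : Y := s⁻¹ • (lh + s • w) with hp
  have hpN : p ∈ N := hNsm _ (inv_nonneg.2 hspos.le) _ hsw
  set ζ : Y := p + (-s⁻¹) • l0 with hζ
  have hAζ : adjL X Y A ζ = adjL X Y A w := by
    rw [hζ, hp, map_add, map_smul, map_add, map_smul, map_smul, adjL_apply, hAll, smul_add,
      smul_smul, inv_mul_cancel₀ hspos.ne', one_smul, neg_smul]
    abel
  have hsymm : ∀ v w, fderiv ℝ (fderiv ℝ Ξ) y0 v w = fderiv ℝ (fderiv ℝ Ξ) y0 w v := fun v w =>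
    (hcd.isSymmSndFDerivAt (by simp)) v w
  have heq : hessLxx f g x0 l0 ξ + ContinuousLinearMap.adjoint A
      (ζ + ContinuousLinearMap.adjoint (fderiv ℝ (fderiv ℝ Ξ) y0 h) μ) = 0 := by
    rw [← adjL_apply A, map_add, hAζ, hwe']
    abel
  have hge := hpos ξ ζ (by rw [aux_grad _ hsymm]; exact heq) hcrit
    ⟨ζ, Set.add_mem_add hpN ⟨-s⁻¹, rfl⟩, rfl⟩
  have hort : ⟪p + (-s⁻¹) • l0, h⟫ = 0 := by
    refine le_antisymm ?_ ?_
    · have e : ⟪(-s⁻¹) • l0, h⟫ = 0 := by rw [real_inner_smul_left, hl0h, mul_zero]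
      rw [inner_add_left, e, add_zero]
      exact hNh p hpN
    · rw [real_inner_comm]; exact hge
  exact hnc ξ _ heq
    (aux_dirderiv hKcl hKcv hD hU hredU hyU hΞ0 hΞ hsurj hμ hlμ hcrit hpN (-s⁻¹) hort)


lemma aux_lip {E F : Type*} [NormedAddCommGroup E] [NormedSpace ℝ E]
    [NormedAddCommGroup F] [NormedSpace ℝ F] {φ : E → F} {y : E}
    (hφ : DifferentiableAt ℝ φ y) :
    ∃ C r : ℝ, 0 ≤ C ∧ 0 < r ∧ ∀ z, ‖z - y‖ ≤ r → ‖φ z - φ y‖ ≤ C * ‖z - y‖ := by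
  obtain ⟨C, hC, hb⟩ := hφ.hasFDerivAt.isBigO_sub.exists_pos
  obtain ⟨r, hr, hb⟩ := Metric.nhds_basis_closedBall.eventually_iff.1 hb.bound
  exact ⟨C, r, hC.le, hr, fun z hz => hb (by rwa [mem_closedBall, dist_eq_norm])⟩

lemma aux_iso {f : X → ℝ} {g : X → Y} {K : Set Y} {x0 : X} {l0 : Y}
    (hcore : ∀ (x a : ℕ → X) (l b : ℕ → Y) (t : ℕ → ℝ) (ξ : X), (∀ n, 0 < t n) →
      Tendsto t atTop (𝓝 0) → Tendsto (fun n => (t n)⁻¹ • (x n - x0)) atTop (𝓝 ξ) →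
      Tendsto (fun n => (t n)⁻¹ • a n) atTop (𝓝 0) →
      Tendsto (fun n => (t n)⁻¹ • b n) atTop (𝓝 0) → Tendsto l atTop (𝓝 l0) →
      (∀ n, (x n, l n) ∈ sKKT f g K (a n) (b n)) → ξ = 0) :
    ∃ ε δ κ : ℝ, 0 < ε ∧ 0 < δ ∧ 0 < κ ∧
    ∀ (a : X) (b : Y), ‖(a, b)‖ ≤ δ →
      ∀ (x : X) (l : Y), (x, l) ∈ sKKT f g K a b → ‖(x, l) - (x0, l0)‖ ≤ ε →
        ‖x - x0‖ ≤ κ * ‖(a, b)‖ := by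
  by_contra hcon
  push Not at hcon
  have hp : ∀ n : ℕ, (0 : ℝ) < 1 / ((n : ℝ) + 1) := fun n => by positivity
  have hq : ∀ n : ℕ, (0 : ℝ) < (n : ℝ) + 1 := fun n => by positivity
  choose a b hab x l hk hxl hlt using fun n : ℕ => hcon _ _ _ (hp n) (hp n) (hq n)
  have hx : ∀ n, ‖x n - x0‖ ≤ 1 / ((n : ℝ) + 1) := fun n =>
    (norm_fst_le ((x n, l n) - (x0, l0))).trans (hxl n)
  have hl : ∀ n, ‖l n - l0‖ ≤ 1 / ((n : ℝ) + 1) := fun n =>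
    (norm_snd_le ((x n, l n) - (x0, l0))).trans (hxl n)
  have ht : ∀ n, 0 < ‖x n - x0‖ := fun n =>
    lt_of_le_of_lt (mul_nonneg (hq n).le (norm_nonneg _)) (hlt n)
  have hlim := tendsto_one_div_add_atTop_nhds_zero_nat (𝕜 := ℝ)
  have ht0 : Tendsto (fun n => ‖x n - x0‖) atTop (𝓝 0) :=
    squeeze_zero (fun n => norm_nonneg _) hx hlim
  have hl0 : Tendsto l atTop (𝓝 l0) := by
    rw [tendsto_iff_norm_sub_tendsto_zero]
    exact squeeze_zero (fun n => norm_nonneg _) hl hlim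
  have hle : ∀ n (r : ℝ), r ≤ ‖(a n, b n)‖ → ‖x n - x0‖⁻¹ * r ≤ 1 / ((n : ℝ) + 1) := by
    intro n r hr
    rw [inv_mul_le_iff₀ (ht n), mul_one_div, le_div_iff₀ (hq n)]
    have := mul_le_mul_of_nonneg_right hr (hq n).le
    linarith [hlt n, mul_comm ((n : ℝ) + 1) ‖(a n, b n)‖]
  have ha0 : Tendsto (fun n => ‖x n - x0‖⁻¹ • a n) atTop (𝓝 0) := by
    refine squeeze_zero_norm (fun n => ?_) hlim
    rw [norm_smul, norm_inv, norm_norm]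
    exact hle n _ (norm_fst_le (a n, b n))
  have hb0 : Tendsto (fun n => ‖x n - x0‖⁻¹ • b n) atTop (𝓝 0) := by
    refine squeeze_zero_norm (fun n => ?_) hlim
    rw [norm_smul, norm_inv, norm_norm]
    exact hle n _ (norm_snd_le (a n, b n))
  have hsph : ∀ n, ‖x n - x0‖⁻¹ • (x n - x0) ∈ sphere (0 : X) 1 := fun n => by
    rw [mem_sphere_zero_iff_norm, norm_smul, norm_inv, norm_norm, inv_mul_cancel₀ (ht n).ne']
  obtain ⟨ξ, hξ, φ, hφ, hlimξ⟩ := (isCompact_sphere (0 : X) 1).tendsto_subseq hsph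
  have hφt := hφ.tendsto_atTop
  have := hcore (x ∘ φ) (a ∘ φ) (l ∘ φ) (b ∘ φ) (fun n => ‖x (φ n) - x0‖) ξ (fun n => ht _)
    (ht0.comp hφt) hlimξ (ha0.comp hφt) (hb0.comp hφt) (hl0.comp hφt) (fun n => hk _)
  rw [mem_sphere_zero_iff_norm, this] at hξ
  simp at hξ

lemma aux_dist {f : X → ℝ} {g : X → Y} {K : Set Y}
    (hf : ContDiff ℝ 2 f) (hg : ContDiff ℝ 2 g) (hKcv : Convex ℝ K)
    {x0 : X} {l0 : Y} (hKKT : (x0, l0) ∈ sKKT f g K 0 0)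
    {m : ℕ} {U : Set Y} {D : Set (EuclideanSpace ℝ (Fin m))}
    {Ξ : Y → EuclideanSpace ℝ (Fin m)}
    (hU : IsOpen U) (hyU : g x0 ∈ U) (hD : PointedClosedConvexCone D)
    (hΞ : ContDiffOn ℝ 2 Ξ U) (hΞ0 : Ξ (g x0) = 0)
    (hsurj : Function.Surjective (fderiv ℝ Ξ (g x0)))
    (hredU : K ∩ U = {y ∈ U | Ξ y ∈ D})
    (hri : (intrinsicInterior ℝ (nCone K (g x0)) ∩ mSet f g K x0 0 0).Nonempty)
    (hiso : ∃ ε δ κ : ℝ, 0 < ε ∧ 0 < δ ∧ 0 < κ ∧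
      ∀ (a : X) (b : Y), ‖(a, b)‖ ≤ δ →
      ∀ (x : X) (l : Y), (x, l) ∈ sKKT f g K a b → ‖(x, l) - (x0, l0)‖ ≤ ε →
        ‖x - x0‖ ≤ κ * ‖(a, b)‖) :
    StrongCalm f g K x0 l0 := by
  obtain ⟨ε1, δ1, κ1, hε1, hδ1, hκ1, hiso⟩ := hiso
  obtain ⟨lh, hlhri, hlhM⟩ := hri
  have hy0K : g x0 ∈ K := by have := hKKT.2.1; simpa using this
  obtain ⟨hN0, hNcv, -⟩ := aux_ncone hy0K
  have hlhN : lh ∈ nCone K (g x0) := by have := hlhM.2; simpa using this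
  have hlhs : gradient f x0 + adjL X Y (fderiv ℝ g x0) lh = 0 := hlhM.1
  obtain ⟨ρ, hρ, hρN⟩ := aux_ri hN0 hlhri
  obtain ⟨C3, hC3, hreg⟩ := aux_reg hNcv (adjL X Y (fderiv ℝ g x0)) hlhN hρ hρN
  obtain ⟨C, hC, hmult⟩ := aux_mult hD hU hredU hyU hΞ hsurj
  obtain ⟨rm, hrm, hmult⟩ := Metric.nhds_basis_closedBall.eventually_iff.1 hmult
  have hcd : ContDiffAt ℝ 2 Ξ (g x0) := hΞ.contDiffAt (hU.mem_nhds hyU)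
  obtain ⟨Cg, rg, hCg, hrg, hlg⟩ := aux_lip (hg.differentiable (by norm_num) x0)
  obtain ⟨Ca, ra, hCa, hra, hla⟩ := aux_lip (aux_diffadj hg x0)
  obtain ⟨Cf, rf, hCf, hrf, hlf⟩ := aux_lip (aux_diffgrad hf x0)
  obtain ⟨CX, rX, hCX, hrX, hlX⟩ := aux_lip
    ((hcd.fderiv_right (m := 1) (by norm_num)).differentiableAt (by norm_num))
  have hpull := fun ν hν => aux_pull (μ := ν) hKcv hU hredU hy0K hyU
    (hcd.differentiableAt (by norm_num)).hasFDerivAt hν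
  rw [hΞ0] at hpull
  obtain ⟨T0, hT0⟩ : ∃ T0, T0 = fderiv ℝ Ξ (g x0) := ⟨_, rfl⟩
  obtain ⟨B, hB⟩ : ∃ B, B = adjL X Y (fderiv ℝ g x0) := ⟨_, rfl⟩
  rw [← hT0] at hlX hpull
  rw [← hB] at hla hreg hlhs
  obtain ⟨Cy, hCy⟩ : ∃ Cy, Cy = Cg * κ1 + 1 := ⟨_, rfl⟩
  have hCy0 : 0 < Cy := by rw [hCy]; positivity
  obtain ⟨V, hV⟩ : ∃ V, V = C * (‖l0‖ + 1) := ⟨_, rfl⟩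
  have hV0 : 0 ≤ V := by rw [hV]; positivity
  obtain ⟨K1, hK1⟩ : ∃ K1, K1 = CX * Cy * V := ⟨_, rfl⟩
  have hK10 : 0 ≤ K1 := by rw [hK1]; positivity
  obtain ⟨K2, hK2⟩ : ∃ K2, K2 = ‖B‖ * K1 + Ca * κ1 * (‖l0‖ + 1) + Cf * κ1 + 1 := ⟨_, rfl⟩
  have hK20 : 0 ≤ K2 := by rw [hK2]; positivity
  obtain ⟨K3, hK3⟩ : ∃ K3, K3 = ‖T0‖ * V + ‖lh‖ := ⟨_, rfl⟩
  have hK30 : 0 ≤ K3 := by rw [hK3]; positivity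
  refine ⟨min δ1 (min (rm / Cy) (rX / Cy)), min ε1 (min 1 (min rg (min ra rf))),
    κ1 + (K1 + C3 * (1 + K3) * K2), by positivity, by positivity, by positivity, ?_⟩
  intro a b hab x l hk hxl
  simp only [le_min_iff] at hab hxl
  obtain ⟨hab1, hab2, hab3⟩ := hab
  obtain ⟨hx1, hx2, hx3, hx4, hx5⟩ := hxl
  have hx := hiso a b hab1 x l hk hx1
  have hxn : ‖x - x0‖ ≤ ‖(x, l) - (x0, l0)‖ := norm_fst_le ((x, l) - (x0, l0))
  have hln : ‖l - l0‖ ≤ ‖(x, l) - (x0, l0)‖ := norm_snd_le ((x, l) - (x0, l0))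
  have han : ‖a‖ ≤ ‖(a, b)‖ := norm_fst_le (a, b)
  have hbn : ‖b‖ ≤ ‖(a, b)‖ := norm_snd_le (a, b)
  obtain ⟨e, he⟩ : ∃ e, e = ‖(a, b)‖ := ⟨_, rfl⟩
  rw [← he] at hab2 hab3 hx han hbn ⊢
  have he0 : 0 ≤ e := he ▸ norm_nonneg _
  rw [le_div_iff₀ hCy0] at hab2 hab3
  have hg1 := hlg x (hxn.trans hx3)
  have ha1 := hla x (hxn.trans hx4)
  have hf1 := hlf x (hxn.trans hx5)
  have hl1 : ‖l‖ ≤ ‖l0‖ + 1 := by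
    have := norm_le_norm_add_norm_sub' l l0
    linarith
  have hy : ‖(g x - b) - g x0‖ ≤ Cy * e := by
    have e1 : (g x - b) - g x0 = (g x - g x0) - b := by abel
    rw [e1, hCy]
    have := norm_sub_le (g x - g x0) b
    have := mul_le_mul_of_nonneg_left hx hCg
    linarith
  have hX1 := hlX (g x - b) (by linarith [mul_comm Cy e])
  obtain ⟨ν, hν, hlν, hνn, -⟩ := hmult
    (by rw [mem_closedBall, dist_eq_norm]; linarith [mul_comm Cy e]) l hk.2
  have hνV : ‖ν‖ ≤ V := hνn.trans (by rw [hV]; exact mul_le_mul_of_nonneg_left hl1 hC)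
  obtain ⟨l1, hl1e⟩ : ∃ l1, l1 = ContinuousLinearMap.adjoint T0 ν := ⟨_, rfl⟩
  have hl1N : l1 ∈ nCone K (g x0) := hl1e ▸ hpull ν hν
  have hll1 : ‖l - l1‖ ≤ K1 * e := by
    have e1 : l - l1 = ContinuousLinearMap.adjoint (fderiv ℝ Ξ (g x - b) - T0) ν := by
      rw [map_sub, ContinuousLinearMap.sub_apply, ← hlν, ← hl1e]
    rw [e1]
    calc _ ≤ ‖ContinuousLinearMap.adjoint (fderiv ℝ Ξ (g x - b) - T0)‖ * ‖ν‖ :=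
          ContinuousLinearMap.le_opNorm _ _
      _ ≤ (CX * (Cy * e)) * V := by
          rw [LinearIsometryEquiv.norm_map]
          exact mul_le_mul (hX1.trans (mul_le_mul_of_nonneg_left hy hCX)) hνV (norm_nonneg _)
            (by positivity)
      _ = K1 * e := by rw [hK1]; ring
  have hBl : ‖B l1 - B lh‖ ≤ K2 * e := by
    have hk1 : gradient f x + adjL X Y (fderiv ℝ g x) l = a := hk.1
    have e1 : B l1 - B lh = -(B (l - l1)) - ((adjL X Y (fderiv ℝ g x) - B) l)
        - (gradient f x - gradient f x0) + a := by
      rw [← hk1, map_sub, ContinuousLinearMap.sub_apply]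
      have : B lh = - gradient f x0 := by rw [eq_neg_iff_add_eq_zero, add_comm]; exact hlhs
      rw [this]; abel
    have n1 : ‖B (l - l1)‖ ≤ ‖B‖ * (K1 * e) :=
      (B.le_opNorm _).trans (mul_le_mul_of_nonneg_left hll1 (norm_nonneg _))
    have n2 : ‖(adjL X Y (fderiv ℝ g x) - B) l‖ ≤ (Ca * (κ1 * e)) * (‖l0‖ + 1) :=
      (ContinuousLinearMap.le_opNorm _ _).trans
        (mul_le_mul (ha1.trans (mul_le_mul_of_nonneg_left hx hCa)) hl1 (norm_nonneg _)
          (by positivity))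
    have n3 : ‖gradient f x - gradient f x0‖ ≤ Cf * (κ1 * e) :=
      hf1.trans (mul_le_mul_of_nonneg_left hx hCf)
    have m1 := norm_add_le (-(B (l - l1)) - ((adjL X Y (fderiv ℝ g x) - B) l)
        - (gradient f x - gradient f x0)) a
    have m2 := norm_sub_le (-(B (l - l1)) - ((adjL X Y (fderiv ℝ g x) - B) l))
        (gradient f x - gradient f x0)
    have m3 := norm_sub_le (-(B (l - l1))) ((adjL X Y (fderiv ℝ g x) - B) l)
    rw [norm_neg] at m3
    have e2 : K2 * e = ‖B‖ * (K1 * e) + (Ca * (κ1 * e)) * (‖l0‖ + 1) + Cf * (κ1 * e) + e := by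
      rw [hK2]; ring
    rw [e1, e2]
    linarith
  have hl1lh : ‖l1 - lh‖ ≤ K3 := by
    have h1 : ‖l1‖ ≤ ‖T0‖ * V := by
      rw [hl1e]
      refine (ContinuousLinearMap.le_opNorm _ _).trans ?_
      rw [LinearIsometryEquiv.norm_map]
      exact mul_le_mul_of_nonneg_left hνV (norm_nonneg _)
    have := norm_sub_le l1 lh
    rw [hK3]; linarith
  obtain ⟨l2, hl2N, hBl2, hl12⟩ := hreg l1 hl1N
  have hl2M : l2 ∈ mSet f g K x0 0 0 := by
    refine ⟨?_, by simpa using hl2N⟩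
    show gradient f x0 + adjL X Y (fderiv ℝ g x0) l2 = 0
    rw [← hB, hBl2, hlhs]
  have hd : infDist l (mSet f g K x0 0 0) ≤ ‖l - l2‖ := by
    rw [← dist_eq_norm]; exact infDist_le_dist_of_mem hl2M
  have h12 : ‖l1 - l2‖ ≤ C3 * (1 + K3) * (K2 * e) :=
    hl12.trans (mul_le_mul (mul_le_mul_of_nonneg_left (by linarith) hC3) hBl (norm_nonneg _)
      (by positivity))
  have htri := norm_sub_le_norm_sub_add_norm_sub l l1 l2
  have e3 : (κ1 + (K1 + C3 * (1 + K3) * K2)) * e = κ1 * e + (K1 * e + C3 * (1 + K3) * (K2 * e)) := by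
    ring
  rw [e3]
  linarith

/-- Theorem 4.1: for a KKT point `(x̄,λ̄)` with `M(x̄,0,0) ≠ {λ̄}`,
if (i) `F(x) = g(x) − K` is metrically subregular at `x̄` for the origin,
(ii) `⟪g'(x̄)ξ, ζ⟫ ≥ 0` for all `(ξ,ζ) ∈ Σ(x̄,λ̄) ∩ Γ̃(x̄,λ̄)` (with `Υ` built from the
`C²`-reduction data `(U, D, Ξ, μ̄)` of `K` at `ȳ = g(x̄)`), and
(iii) `ri(N_K(g(x̄))) ∩ M(x̄,0,0) ≠ ∅`, then noncriticality of `λ̄` implies the strong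
calmness of `S_KKT` at the origin for `(x̄,λ̄)`. -/
theorem stmt_13 (f : X → ℝ) (g : X → Y) (K : Set Y)
    (hf : ContDiff ℝ 2 f) (hg : ContDiff ℝ 2 g)
    (hKne : K.Nonempty) (hKcl : IsClosed K) (hKcv : Convex ℝ K)
    (hKred : C2ConeReducible K)
    (x0 : X) (l0 : Y) (hKKT : (x0, l0) ∈ sKKT f g K 0 0)
    (hMne : mSet f g K x0 0 0 ≠ {l0})
    (m : ℕ) (U : Set Y) (D : Set (EuclideanSpace ℝ (Fin m)))
    (Ξ : Y → EuclideanSpace ℝ (Fin m))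
    (hU : IsOpen U) (hyU : g x0 ∈ U) (hD : PointedClosedConvexCone D)
    (hΞ : ContDiffOn ℝ 2 Ξ U) (hΞ0 : Ξ (g x0) = 0)
    (hsurj : Function.Surjective (fderiv ℝ Ξ (g x0)))
    (hredU : K ∩ U = {y ∈ U | Ξ y ∈ D})
    (μ : EuclideanSpace ℝ (Fin m)) (hμ : μ ∈ nCone D (Ξ (g x0)))
    (hlμ : l0 = ContinuousLinearMap.adjoint (fderiv ℝ Ξ (g x0)) μ)
    (hsub : MetricallySubregular
      (fun x : X => {w : Y | ∃ k ∈ K, w = g x - k}) x0 (0 : Y))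
    (hpos : ∀ (ξ : X) (ζ : Y),
      hessLxx f g x0 l0 ξ + ContinuousLinearMap.adjoint (fderiv ℝ g x0)
          (ζ + (1 / 2 : ℝ) •
            gradient (fun h : Y => ⟪μ, fderiv ℝ (fderiv ℝ Ξ) (g x0) h h⟫)
              (fderiv ℝ g x0 ξ)) = 0 →
      fderiv ℝ g x0 ξ ∈ criticalCone K (g x0) l0 →
      ContinuousLinearMap.adjoint (fderiv ℝ g x0) ζ ∈
        ContinuousLinearMap.adjoint (fderiv ℝ g x0) ''
          (nCone K (g x0) + Set.range fun t : ℝ => t • l0) →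
      0 ≤ ⟪fderiv ℝ g x0 ξ, ζ⟫)
    (hri : (intrinsicInterior ℝ (nCone K (g x0)) ∩ mSet f g K x0 0 0).Nonempty)
    (hnc : Noncritical f g K x0 l0) :
    StrongCalm f g K x0 l0 := by
  exact aux_dist hf hg hKcv hKKT hU hyU hD hΞ hΞ0 hsurj hredU hri
    (aux_iso fun x a l b t ξ ht ht0 hξ ha hb hl hk =>
      aux_core hf hg hKcl hKcv hKKT hU hyU hD hΞ hΞ0 hsurj hredU hμ hlμ hpos hri hnc
        ht ht0 hξ ha hb hl hk)

end
end

section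
/- Let (x̄,λ̄) be a KKT point of the unperturbed problem (a,b)=(0,0). If the second-order sufficient condition holds at x̄ with respect to λ̄, i.e., ⟨d, ∇²ₓₓL(x̄,λ̄)d⟩ − σ(λ̄, T²_K(g(x̄), g'(x̄)d)) > 0 for every nonzero d in the critical cone C(x̄) = {d ∈ X : g'(x̄)d ∈ C_K(g(x̄),λ̄)}, then the multiplier λ̄ is noncritical. -/
open Set Filter Topology Metric Pointwise
open scoped RealInnerProductSpace Classical

noncomputable section

variable {X Y : Type*} [NormedAddCommGroup X] [InnerProductSpace ℝ X]
  [FiniteDimensional ℝ X] [NormedAddCommGroup Y] [InnerProductSpace ℝ Y]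
  [FiniteDimensional ℝ Y]

theorem aux_projK {E : Type*} [NormedAddCommGroup E] [InnerProductSpace ℝ E]
    [FiniteDimensional ℝ E] {K : Set E} (hne : K.Nonempty) (hcl : IsClosed K)
    (hcv : Convex ℝ K) (z : E) :
    projK K z ∈ K ∧ ∀ k ∈ K, ⟪z - projK K z, k - projK K z⟫ ≤ 0 := by
  have : CompleteSpace E := FiniteDimensional.complete ℝ E
  have : Nonempty K := hne.to_subtype
  have hbdd : BddBelow (range fun w : K => ‖z - (w : E)‖) :=
    ⟨0, by rintro _ ⟨w, rfl⟩; exact norm_nonneg _⟩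
  have hex : ∃ p, p ∈ K ∧ ∀ y ∈ K, ‖z - p‖ ≤ ‖z - y‖ := by
    obtain ⟨p, hp, h⟩ := exists_norm_eq_iInf_of_complete_convex hne hcl.isComplete hcv z
    refine ⟨p, hp, fun y hy => ?_⟩
    rw [h]
    exact ciInf_le hbdd (⟨y, hy⟩ : K)
  have hs := hex.choose_spec
  have he : projK K z = hex.choose := by
    unfold projK; rw [dif_pos hex]
  rw [he]
  refine ⟨hs.1, ?_⟩
  refine (norm_eq_iInf_iff_real_inner_le_zero hcv hs.1).1 (le_antisymm ?_ ?_)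
  · exact le_ciInf fun w => hs.2 w w.2
  · exact ciInf_le hbdd (⟨_, hs.1⟩ : K)

theorem aux_projK_eq {E : Type*} [NormedAddCommGroup E] [InnerProductSpace ℝ E]
    [FiniteDimensional ℝ E] {K : Set E} (hne : K.Nonempty) (hcl : IsClosed K)
    (hcv : Convex ℝ K) {y l : E} (hl : l ∈ nCone K y) : projK K (y + l) = y := by
  obtain ⟨h1, h2⟩ := aux_projK hne hcl hcv (y + l)
  set p := projK K (y + l)
  have h3 := h2 y hl.1
  have h4 := hl.2 p h1
  have h5 : ⟪y + l - p, y - p⟫ = ⟪y - p, y - p⟫ - ⟪l, p - y⟫ := by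
    simp only [inner_sub_left, inner_sub_right, inner_add_left]; ring
  have h6 : ⟪y - p, y - p⟫ ≤ 0 := by linarith
  rw [real_inner_self_eq_norm_sq] at h6
  have h7 : ‖y - p‖ = 0 := by nlinarith [norm_nonneg (y - p)]
  exact (sub_eq_zero.1 (norm_eq_zero.1 h7)).symm

structure AuxPkg {E : Type*} [NormedAddCommGroup E] [InnerProductSpace ℝ E]
    (K : Set E) (y : E) (m : ℕ) (D : Set (EuclideanSpace ℝ (Fin m)))
    (Ξ : E → EuclideanSpace ℝ (Fin m)) (A : E →L[ℝ] EuclideanSpace ℝ (Fin m))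
    (S : EuclideanSpace ℝ (Fin m) → E) (M L r : ℝ) : Prop where
  hM : 0 < M
  hL : 0 ≤ L
  hr : 0 < r
  hcl : IsClosed D
  hcone : ∀ t : ℝ, 0 ≤ t → ∀ z ∈ D, t • z ∈ D
  h0 : Ξ y = 0
  hAS : ∀ e, A (S e) = e
  hS : ∀ e, ‖S e‖ ≤ M * ‖e‖
  happ : ∀ ρ ≤ r, ∀ a ∈ closedBall y ρ, ∀ b ∈ closedBall y ρ,
    ‖Ξ a - Ξ b - A (a - b)‖ ≤ L * ρ * ‖a - b‖
  hK : ∀ a ∈ closedBall y r, (a ∈ K ↔ Ξ a ∈ D)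
  hreg : ∀ b ε e, 0 ≤ ε → closedBall b ε ⊆ closedBall y r → ‖e - Ξ b‖ ≤ ε / (2 * M) →
    ∃ q ∈ closedBall b ε, Ξ q = e

theorem aux_pkg {E : Type*} [NormedAddCommGroup E] [InnerProductSpace ℝ E]
    [FiniteDimensional ℝ E] {K : Set E} {y : E} (h : C2ConeReducibleAt K y) :
    ∃ m D Ξ A S M L r, AuxPkg K y m D Ξ A S M L r := by
  have : CompleteSpace E := FiniteDimensional.complete ℝ E
  obtain ⟨m, U, D, Ξ, hU, hyU, hD, hΞ, h0, hsurj, hKU⟩ := h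
  have hc : ContDiffAt ℝ 2 Ξ y := hΞ.contDiffAt (hU.mem_nhds hyU)
  have hc1 : ContDiffAt ℝ 1 (fderiv ℝ Ξ) y := hc.fderiv_right (by norm_num)
  obtain ⟨L, T, hT, hLip⟩ := hc1.exists_lipschitzOnWith
  obtain ⟨r0, hr0, hball⟩ := Metric.nhds_basis_closedBall.mem_iff.1
    (Filter.inter_mem hT (hU.mem_nhds hyU))
  set A := fderiv ℝ Ξ y with hA
  have hrange : (A : E →ₗ[ℝ] EuclideanSpace ℝ (Fin m)).range = ⊤ :=
    LinearMap.range_eq_top.2 hsurj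
  set R := A.nonlinearRightInverseOfSurjective hrange with hR
  have hM : 0 < R.nnnorm := A.nonlinearRightInverseOfSurjective_nnnorm_pos hrange
  have hM' : (0 : ℝ) < R.nnnorm := hM
  have hLM : (0 : ℝ) < 2 * R.nnnorm * (L + 1) := by positivity
  set r := min r0 (1 / (2 * R.nnnorm * (L + 1)) : ℝ) with hrdef
  have hr : 0 < r := lt_min hr0 (by positivity)
  have happ : ∀ ρ ≤ r, ∀ a ∈ closedBall y ρ, ∀ b ∈ closedBall y ρ,
      ‖Ξ a - Ξ b - A (a - b)‖ ≤ L * ρ * ‖a - b‖ := by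
    intro ρ hρ a ha b hb
    have hsub : closedBall y ρ ⊆ T ∩ U :=
      (closedBall_subset_closedBall (hρ.trans (min_le_left _ _))).trans hball
    refine Convex.norm_image_sub_le_of_norm_fderiv_le' (𝕜 := ℝ) (s := closedBall y ρ)
      (fun x hx => ?_) (fun x hx => ?_) (convex_closedBall _ _) hb ha
    · exact (hΞ.contDiffAt (hU.mem_nhds (hsub hx).2)).differentiableAt (by norm_num)
    · have h1 := hLip.dist_le_mul x (hsub hx).1 y (mem_of_mem_nhds hT)
      rw [dist_eq_norm] at h1
      exact h1.trans (mul_le_mul_of_nonneg_left hx L.2)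
  have hc2 : (L : ℝ) * r ≤ (R.nnnorm : ℝ)⁻¹ / 2 := by
    have h1 : r ≤ 1 / (2 * R.nnnorm * (L + 1)) := min_le_right _ _
    have h2 : (L : ℝ) * r ≤ (L + 1) * (1 / (2 * R.nnnorm * (L + 1))) := by
      apply mul_le_mul _ h1 hr.le <;> linarith
    refine h2.trans (le_of_eq ?_)
    have : (L : ℝ) + 1 ≠ 0 := by positivity
    field_simp
  refine ⟨m, D, Ξ, A, R, R.nnnorm, L, r, hM', L.2, hr, hD.1, hD.2.2.1, h0,
    fun e => R.right_inv e, fun e => R.bound e, happ, ?_, ?_⟩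
  · intro a ha
    have haU : a ∈ U := (hball (closedBall_subset_closedBall (min_le_left _ _) ha)).2
    have := Set.ext_iff.1 hKU a
    simp only [mem_inter_iff, haU, and_true, Set.mem_ofPred_eq, true_and] at this
    exact this
  · intro b ε e hε hsub he
    have hap : ApproximatesLinearOn Ξ A (closedBall y r) ((R.nnnorm)⁻¹ / 2) := by
      intro a ha b hb
      refine (happ r le_rfl a ha b hb).trans ?_
      refine mul_le_mul_of_nonneg_right ?_ (norm_nonneg _)
      simpa using hc2
    have := hap.surjOn_closedBall_of_nonlinearRightInverse R hε hsub
    have he' : e ∈ closedBall (Ξ b)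
        (((R.nnnorm : ℝ)⁻¹ - (((R.nnnorm)⁻¹ / 2 : NNReal) : ℝ)) * ε) := by
      rw [mem_closedBall, dist_eq_norm]
      refine he.trans (le_of_eq ?_)
      push_cast
      field_simp
      ring
    obtain ⟨q, hq, hqe⟩ := this he'
    exact ⟨q, hq, hqe⟩

section auxsec
variable {E : Type*} [NormedAddCommGroup E] [InnerProductSpace ℝ E]
  {K : Set E} {y : E} {m : ℕ} {D : Set (EuclideanSpace ℝ (Fin m))}
  {Ξ : E → EuclideanSpace ℝ (Fin m)} {A : E →L[ℝ] EuclideanSpace ℝ (Fin m)}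
  {S : EuclideanSpace ℝ (Fin m) → E} {M L r : ℝ}

theorem aux_curve_s17 (P : AuxPkg K y m D Ξ A S M L r) {h : E} (hh : A h ∈ D) :
    ∃ C τ : ℝ, 0 ≤ C ∧ 0 < τ ∧ ∀ t : ℝ, 0 < t → t ≤ τ →
      ∃ q ∈ K, Ξ q = t • A h ∧ ‖q - y - t • h‖ ≤ C * t ^ 2 ∧ q ∈ closedBall y r := by
  have hM := P.hM
  have hL := P.hL
  have hr := P.hr
  set B := ‖h‖ + 2 * M * L * ‖h‖ ^ 2 with hB
  have hB0 : 0 ≤ B := by positivity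
  refine ⟨2 * M * L * ‖h‖ ^ 2, min 1 (r / (1 + B)), by positivity,
    lt_min one_pos (by positivity), fun t ht htτ => ?_⟩
  have ht1 : t ≤ 1 := htτ.trans (min_le_left _ _)
  have ht2 : t * (1 + B) ≤ r := by
    have := htτ.trans (min_le_right _ _)
    rwa [le_div_iff₀ (by positivity)] at this
  have htt : t ^ 2 ≤ t := by nlinarith
  have hnb : ‖t • h‖ = t * ‖h‖ := by rw [norm_smul, Real.norm_of_nonneg ht.le]
  have htB : t * ‖h‖ + 2 * M * L * ‖h‖ ^ 2 * t ^ 2 ≤ r := by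
    have : 2 * M * L * ‖h‖ ^ 2 * t ^ 2 ≤ 2 * M * L * ‖h‖ ^ 2 * t :=
      mul_le_mul_of_nonneg_left htt (by positivity)
    nlinarith
  have hpos : 0 ≤ 2 * M * L * ‖h‖ ^ 2 * t ^ 2 := by positivity
  have hsub : closedBall (y + t • h) (2 * M * L * ‖h‖ ^ 2 * t ^ 2) ⊆ closedBall y r := by
    apply closedBall_subset_closedBall'
    rw [dist_eq_norm, add_sub_cancel_left, hnb]
    linarith
  obtain ⟨q, hq, hqe⟩ := P.hreg (y + t • h) (2 * M * L * ‖h‖ ^ 2 * t ^ 2) (t • A h) hpos hsub (by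
    have h1 := P.happ (t * ‖h‖) (by linarith) (y + t • h)
      (by rw [mem_closedBall, dist_eq_norm, add_sub_cancel_left, hnb]) y
      (mem_closedBall_self (by positivity))
    rw [P.h0, add_sub_cancel_left, sub_zero, map_smul, hnb] at h1
    rw [norm_sub_rev]
    refine h1.trans (le_of_eq ?_)
    field_simp)
  refine ⟨q, ?_, hqe, ?_, hsub hq⟩
  · rw [P.hK q (hsub hq), hqe]
    exact P.hcone t ht.le _ hh
  · rw [mem_closedBall, dist_eq_norm] at hq
    rwa [sub_sub]

theorem aux_polar (P : AuxPkg K y m D Ξ A S M L r) {l : E} (hl : l ∈ nCone K y) {d : E}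
    (hd : A d ∈ D) : ⟪l, d⟫ ≤ 0 := by
  obtain ⟨C, τ, hC, hτ, H⟩ := aux_curve_s17 P hd
  have h1 : ∀ᶠ t : ℝ in 𝓝[>] 0, ⟪l, d⟫ ≤ ‖l‖ * C * t := by
    filter_upwards [Ioc_mem_nhdsGT hτ] with t ht
    obtain ⟨q, hqK, -, hq, -⟩ := H t ht.1 ht.2
    have h2 := hl.2 q hqK
    have h3 : ⟪l, q - y⟫ = t * ⟪l, d⟫ + ⟪l, q - y - t • d⟫ := by
      rw [inner_sub_right _ (q - y), inner_smul_right]; ring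
    have h4 := abs_le.1 ((abs_real_inner_le_norm l (q - y - t • d)).trans
      (mul_le_mul_of_nonneg_left hq (norm_nonneg l)))
    have h5 : t * ⟪l, d⟫ ≤ t * (‖l‖ * C * t) := by nlinarith [h4.1]
    exact le_of_mul_le_mul_left h5 ht.1
  have h2 : Tendsto (fun t : ℝ => ‖l‖ * C * t) (𝓝[>] 0) (𝓝 (‖l‖ * C * 0)) :=
    (tendsto_const_nhds.mul tendsto_id).mono_left nhdsWithin_le_nhds
  rw [mul_zero] at h2
  exact ge_of_tendsto h2 h1

theorem aux_compare (P : AuxPkg K y m D Ξ A S M L r) {l : E} (hl : l ∈ nCone K y) {h p q : E}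
    (hlh : ⟪l, h⟫ = 0) {t ρ : ℝ} (hρ : ρ ≤ r) (hp : p ∈ closedBall y ρ) (hq : q ∈ closedBall y ρ)
    (hpK : p ∈ K) (hqe : Ξ q = t • A h) :
    ⟪l, p - q⟫ ≤ ‖l‖ * (M * (L * ρ * ‖p - q‖)) := by
  have h1 := P.happ ρ hρ p hp q hq
  set δ := Ξ p - Ξ q - A (p - q) with hδ
  have hpD : Ξ p ∈ D := (P.hK p (closedBall_subset_closedBall hρ hp)).1 hpK
  have h2 : ⟪l, p - q + t • h + S δ⟫ ≤ 0 := by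
    apply aux_polar P hl
    have : A (p - q + t • h + S δ) = Ξ p := by
      rw [map_add, map_add, P.hAS, map_smul, ← hqe, hδ]; abel
    rwa [this]
  rw [inner_add_right, inner_add_right, inner_smul_right, hlh] at h2
  have h3 := abs_le.1 ((abs_real_inner_le_norm l (S δ)).trans
    (mul_le_mul_of_nonneg_left ((P.hS δ).trans (mul_le_mul_of_nonneg_left h1 P.hM.le))
      (norm_nonneg l)))
  linarith [h3.1]

theorem aux_AhD (P : AuxPkg K y m D Ξ A S M L r) {h : E} {p : ℝ → E} (hpK : ∀ t, p t ∈ K)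
    (hp : Tendsto (fun t : ℝ => t⁻¹ • (p t - y)) (𝓝[>] 0) (𝓝 h)) : A h ∈ D := by
  have hid : Tendsto (fun t : ℝ => t) (𝓝[>] 0) (𝓝 0) := tendsto_id.mono_left nhdsWithin_le_nhds
  have h1 : Tendsto (fun t : ℝ => t • (t⁻¹ • (p t - y))) (𝓝[>] 0) (𝓝 0) := by
    simpa using hid.smul hp
  have h2 : Tendsto (fun t => L * ‖t • (t⁻¹ • (p t - y))‖ * ‖t⁻¹ • (p t - y)‖) (𝓝[>] 0) (𝓝 0) := by
    simpa using (h1.norm.const_mul L).mul hp.norm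
  have hev : ∀ᶠ t : ℝ in 𝓝[>] 0, ‖t • (t⁻¹ • (p t - y))‖ < r :=
    h1.norm.eventually_lt_const (by simpa using P.hr)
  have h3 : Tendsto (fun t => t⁻¹ • Ξ (p t) - A (t⁻¹ • (p t - y))) (𝓝[>] 0) (𝓝 0) := by
    refine squeeze_zero_norm' ?_ h2
    filter_upwards [self_mem_nhdsWithin, hev] with t ht hr
    have ht' : (0 : ℝ) < t := ht
    rw [smul_inv_smul₀ ht'.ne'] at hr ⊢
    have h4 := P.happ ‖p t - y‖ hr.le (p t) (by rw [mem_closedBall, dist_eq_norm]) y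
      (mem_closedBall_self (norm_nonneg _))
    rw [P.h0, sub_zero] at h4
    rw [map_smul, ← smul_sub, norm_smul, norm_smul]
    calc _ ≤ ‖t⁻¹‖ * (L * ‖p t - y‖ * ‖p t - y‖) := mul_le_mul_of_nonneg_left h4 (norm_nonneg _)
      _ = _ := by ring
  have h4 : Tendsto (fun t => t⁻¹ • Ξ (p t)) (𝓝[>] 0) (𝓝 (A h)) := by
    simpa using h3.add ((A.continuous.tendsto h).comp hp)
  refine P.hcl.mem_of_tendsto h4 ?_
  filter_upwards [self_mem_nhdsWithin, hev] with t ht hr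
  have ht' : (0 : ℝ) < t := ht
  rw [smul_inv_smul₀ ht'.ne'] at hr
  refine P.hcone _ (inv_nonneg.2 ht'.le) _ ((P.hK _ ?_).1 (hpK t))
  rw [mem_closedBall, dist_eq_norm]
  exact hr.le

/-- lower second-order estimate along projected path -/
theorem aux_lower {l v h : E} {p : ℝ → E} (h0 : p 0 = y)
    (hp : Tendsto (fun t : ℝ => t⁻¹ • (p t - y)) (𝓝[>] 0) (𝓝 h))
    (hvar : ∀ s t : ℝ, ⟪y + l + t • (h + v) - p t, p s - p t⟫ ≤ 0) {η : ℝ} (hη : 0 < η) :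
    ∀ᶠ t : ℝ in 𝓝[>] 0, -(t ^ 2 / 2 * ⟪v, h⟫) - η * t ^ 2 ≤ ⟪l, p t - y⟫ := by
  set c := ⟪v, h⟫ with hc
  set B := 2 * ‖v‖ + ‖h‖ + 2 with hB
  have hB0 : 0 < B := by positivity
  obtain ⟨N, hN⟩ := exists_nat_gt (|c| / η)
  have hNpos : (0 : ℝ) < N := lt_of_le_of_lt (by positivity) hN
  have hN1 : |c| ≤ N * η := by
    rw [div_lt_iff₀ hη] at hN; exact hN.le
  set ε := min 1 (η / (2 * N * B)) with hε
  have hε0 : 0 < ε := lt_min one_pos (by positivity)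
  have hε1 : ε ≤ 1 := min_le_left _ _
  have hε2 : N * (B * ε) ≤ η / 2 := by
    have h1 : ε ≤ η / (2 * N * B) := min_le_right _ _
    rw [le_div_iff₀ (by positivity)] at h1
    nlinarith
  have hev : ∀ᶠ t : ℝ in 𝓝[>] 0, ‖t⁻¹ • (p t - y) - h‖ < ε := by
    have := hp.eventually (Metric.ball_mem_nhds h hε0)
    simpa [mem_ball, dist_eq_norm] using this
  obtain ⟨τ, hτ, hτs⟩ := (mem_nhdsGT_iff_exists_Ioc_subset).1 hev
  have hτ0 : (0 : ℝ) < τ := hτ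
  have hrt : ∀ t, 0 ≤ t → t ≤ τ → ‖p t - y - t • h‖ ≤ ε * t := by
    intro t ht htτ
    rcases ht.eq_or_lt with rfl | ht
    · simp [h0]
    have h1 : ‖t⁻¹ • (p t - y) - h‖ < ε := hτs ⟨ht, htτ⟩
    have h2 : p t - y - t • h = t • (t⁻¹ • (p t - y) - h) := by
      rw [smul_sub, smul_inv_smul₀ ht.ne']
    rw [h2, norm_smul, Real.norm_of_nonneg ht.le, mul_comm]
    exact mul_le_mul_of_nonneg_right h1.le ht.le
  have hstep : ∀ T s t : ℝ, 0 ≤ s → s ≤ t → t ≤ T → T ≤ τ →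
      -(t * (t - s) * c) - B * ε * T ^ 2 ≤ ⟪l, p t - p s⟫ := by
    intro T s t hs hst htT hT
    have hT0 : 0 ≤ T := by linarith
    have h1 := hvar s t
    have hrs := (hrt s hs (by linarith)).trans
      (mul_le_mul_of_nonneg_left (hst.trans htT) hε0.le)
    have hr := (hrt t (by linarith) (by linarith)).trans (mul_le_mul_of_nonneg_left htT hε0.le)
    obtain ⟨a, ha⟩ : ∃ a, a = p t - y - t • h := ⟨_, rfl⟩
    obtain ⟨b, hb⟩ : ∃ b, b = p s - y - s • h := ⟨_, rfl⟩
    rw [← ha] at hr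
    rw [← hb] at hrs
    have e1 : y + l + t • (h + v) - p t = l + t • v - a := by rw [ha, smul_add]; abel
    have e2 : p s - p t = -((t - s) • h + (a - b)) := by rw [ha, hb, sub_smul]; abel
    have e3 : p t - p s = (t - s) • h + (a - b) := by rw [← neg_sub, e2, neg_neg]
    have hab : ‖a - b‖ ≤ 2 * (ε * T) := (norm_sub_le a b).trans (by linarith)
    rw [e1, e2, inner_neg_right, inner_sub_left, inner_add_left, ← e3] at h1
    have h2 : ⟪t • v, p t - p s⟫ = t * (t - s) * c + t * ⟪v, a - b⟫ := by
      rw [e3, inner_add_right, inner_smul_left, inner_smul_left, inner_smul_right]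
      simp; ring
    have h3 : ⟪a, p t - p s⟫ = (t - s) * ⟪a, h⟫ + ⟪a, a - b⟫ := by
      rw [e3, inner_add_right, inner_smul_right]
    have h4 : t * ⟪v, a - b⟫ ≤ T * (‖v‖ * (2 * (ε * T))) := by
      have : ⟪v, a - b⟫ ≤ ‖v‖ * (2 * (ε * T)) :=
        (real_inner_le_norm _ _).trans (mul_le_mul_of_nonneg_left hab (norm_nonneg _))
      exact (mul_le_mul_of_nonneg_left this (by linarith)).trans
        (mul_le_mul_of_nonneg_right htT (by positivity))
    have h5 : -((t - s) * ⟪a, h⟫) ≤ T * ((ε * T) * ‖h‖) := by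
      have : -⟪a, h⟫ ≤ (ε * T) * ‖h‖ := by
        have h6 := (abs_le.1 (abs_real_inner_le_norm a h)).1
        have h7 := mul_le_mul_of_nonneg_right hr (norm_nonneg h)
        linarith
      have h8 := (mul_le_mul_of_nonneg_left this (sub_nonneg.2 hst)).trans
        (mul_le_mul_of_nonneg_right (by linarith : t - s ≤ T) (by positivity))
      linarith
    have h6 : -⟪a, a - b⟫ ≤ (ε * T) * (2 * (1 * T)) := by
      have h6 := (abs_le.1 (abs_real_inner_le_norm a (a - b))).1
      have h7 := mul_le_mul hr hab (norm_nonneg _) (by positivity)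
      have h8 : (ε * T) * (2 * (ε * T)) ≤ (ε * T) * (2 * (1 * T)) := by gcongr
      linarith
    rw [h2, h3] at h1
    have h7 : B * ε * T ^ 2 = T * (‖v‖ * (2 * (ε * T))) + T * ((ε * T) * ‖h‖)
        + (ε * T) * (2 * (1 * T)) := by rw [hB]; ring
    linarith
  filter_upwards [Ioc_mem_nhdsGT hτ0] with T hT
  have hT0 := hT.1
  have hind : ∀ k : ℕ, k ≤ N → -((T / N) ^ 2 * c * (k * (k + 1) / 2)) - k * (B * ε * T ^ 2)
      ≤ ⟪l, p (k * (T / N)) - y⟫ := by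
    intro k
    induction k with
    | zero => intro _; simp [h0]
    | succ k ih =>
      intro hk
      have ih' := ih (by omega)
      have hkN : ((k + 1 : ℕ) : ℝ) ≤ N := by exact_mod_cast hk
      have hTN : 0 < T / N := by positivity
      have h1 := hstep T (k * (T / N)) ((k + 1 : ℕ) * (T / N)) (by positivity)
        (by push_cast; nlinarith) (by
          calc ((k + 1 : ℕ) : ℝ) * (T / N) ≤ N * (T / N) :=
                mul_le_mul_of_nonneg_right hkN hTN.le
            _ = T := by field_simp) hT.2
      have h2 : ⟪l, p ((k + 1 : ℕ) * (T / N)) - y⟫ =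
          ⟪l, p ((k + 1 : ℕ) * (T / N)) - p (k * (T / N))⟫ + ⟪l, p (k * (T / N)) - y⟫ := by
        rw [← inner_add_right, sub_add_sub_cancel]
      rw [h2]
      refine le_trans (le_of_eq ?_) (add_le_add h1 ih')
      push_cast
      ring
  have h1 := hind N le_rfl
  have h2 : (N : ℝ) * (T / N) = T := by field_simp
  rw [h2] at h1
  refine le_trans ?_ h1
  have h3 : (T / N) ^ 2 * c * (N * (N + 1) / 2) = T ^ 2 / 2 * c + T ^ 2 / 2 * (c / N) := by
    field_simp
  have h4 : c / N ≤ η := by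
    rw [div_le_iff₀ hNpos]; linarith [le_abs_self c]
  have h5 : T ^ 2 / 2 * (c / N) ≤ T ^ 2 / 2 * η := mul_le_mul_of_nonneg_left h4 (by positivity)
  have h6 : N * (B * ε * T ^ 2) ≤ η / 2 * T ^ 2 := by
    have := mul_le_mul_of_nonneg_right hε2 (sq_nonneg T)
    linarith
  rw [h3]
  linarith

theorem aux_upper (P : AuxPkg K y m D Ξ A S M L r) {l : E} (hl : l ∈ nCone K y) {h : E}
    (hlh : ⟪l, h⟫ = 0) {p q : ℝ → E} (hpK : ∀ t, p t ∈ K)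
    (hp : Tendsto (fun t : ℝ => t⁻¹ • (p t - y)) (𝓝[>] 0) (𝓝 h)) {C τ : ℝ} (hC : 0 ≤ C)
    (hτ : 0 < τ) (hq : ∀ t, 0 < t → t ≤ τ → Ξ (q t) = t • A h ∧ ‖q t - y - t • h‖ ≤ C * t ^ 2)
    {η : ℝ} (hη : 0 < η) :
    ∀ᶠ t : ℝ in 𝓝[>] 0, ⟪l, p t - q t⟫ ≤ η * t ^ 2 := by
  have hid : Tendsto (fun t : ℝ => t) (𝓝[>] 0) (𝓝 0) := tendsto_id.mono_left nhdsWithin_le_nhds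
  have hM := P.hM
  have hL := P.hL
  set α : ℝ → ℝ := fun t => ‖t⁻¹ • (p t - y) - h‖ + C * t with hα
  have hα0 : Tendsto α (𝓝[>] 0) (𝓝 0) := by
    have := (tendsto_sub_nhds_zero_iff.2 hp).norm.add (hid.const_mul C)
    simpa using this
  have h1 : Tendsto (fun t => t * (‖h‖ + α t)) (𝓝[>] 0) (𝓝 0) := by
    simpa using hid.mul (hα0.const_add ‖h‖)
  have h2 : Tendsto (fun t => ‖l‖ * (M * (L * (‖h‖ + α t) * α t))) (𝓝[>] 0) (𝓝 0) := by
    have := (((hα0.const_add ‖h‖).const_mul L).mul hα0).const_mul M |>.const_mul ‖l‖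
    simpa using this
  filter_upwards [Ioc_mem_nhdsGT hτ, h1.eventually_lt_const P.hr, h2.eventually_lt_const hη]
    with t ht hr hlt
  have ht0 := ht.1
  obtain ⟨hq1, hq2⟩ := hq t ht.1 ht.2
  have hpt : ‖p t - y - t • h‖ = t * ‖t⁻¹ • (p t - y) - h‖ := by
    have h2 : p t - y - t • h = t • (t⁻¹ • (p t - y) - h) := by
      rw [smul_sub, smul_inv_smul₀ ht0.ne']
    rw [h2, norm_smul, Real.norm_of_nonneg ht0.le]
  have hth : ‖t • h‖ = t * ‖h‖ := by rw [norm_smul, Real.norm_of_nonneg ht0.le]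
  have hCt : 0 ≤ C * t := by positivity
  have hnn := norm_nonneg (t⁻¹ • (p t - y) - h)
  have hαt : t * α t = t * ‖t⁻¹ • (p t - y) - h‖ + C * t ^ 2 := by rw [hα]; ring
  have hpb : p t ∈ closedBall y (t * (‖h‖ + α t)) := by
    rw [mem_closedBall, dist_eq_norm]
    have := norm_add_le (p t - y - t • h) (t • h)
    rw [sub_add_cancel] at this
    nlinarith
  have hqb : q t ∈ closedBall y (t * (‖h‖ + α t)) := by
    rw [mem_closedBall, dist_eq_norm]
    have := norm_add_le (q t - y - t • h) (t • h)
    rw [sub_add_cancel] at this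
    nlinarith
  have hpq : ‖p t - q t‖ ≤ t * α t := by
    have := norm_sub_le (p t - y - t • h) (q t - y - t • h)
    rw [sub_sub_sub_cancel_right, sub_sub_sub_cancel_right] at this
    linarith
  have hα' : 0 ≤ α t := by simp only [hα]; positivity
  have h3 := aux_compare P hl hlh hr.le hpb hqb (hpK t) hq1
  refine h3.trans ?_
  calc ‖l‖ * (M * (L * (t * (‖h‖ + α t)) * ‖p t - q t‖))
      ≤ ‖l‖ * (M * (L * (t * (‖h‖ + α t)) * (t * α t))) := by gcongr
    _ = (‖l‖ * (M * (L * (‖h‖ + α t) * α t))) * t ^ 2 := by ring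
    _ ≤ η * t ^ 2 := mul_le_mul_of_nonneg_right hlt.le (sq_nonneg t)

theorem aux_main [FiniteDimensional ℝ E] (hne : K.Nonempty) (hcl : IsClosed K)
    (hcv : Convex ℝ K) (hred : C2ConeReducibleAt K y) {l h v : E} (hl : l ∈ nCone K y)
    (hdd : HasDirDeriv (projK K) (y + l) (h + v) h) :
    h ∈ criticalCone K y l ∧ ∃ w ∈ secondOrderTangent K y h, -⟪v, h⟫ ≤ ⟪l, w⟫ := by
  obtain ⟨m, D, Ξ, A, S, M, L, r, P⟩ := aux_pkg hred
  have hpy : projK K (y + l) = y := aux_projK_eq hne hcl hcv hl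
  obtain ⟨p, hpdef⟩ : ∃ p : ℝ → E, p = fun t => projK K (y + l + t • (h + v)) := ⟨_, rfl⟩
  have hp0 : p 0 = y := by simp [hpdef, hpy]
  have hpK : ∀ t, p t ∈ K := fun t => by rw [hpdef]; exact (aux_projK hne hcl hcv _).1
  have hvar : ∀ s t : ℝ, ⟪y + l + t • (h + v) - p t, p s - p t⟫ ≤ 0 := by
    intro s t
    have := (aux_projK hne hcl hcv (y + l + t • (h + v))).2 (p s) (hpK s)
    simpa only [hpdef] using this
  have hp : Tendsto (fun t : ℝ => t⁻¹ • (p t - y)) (𝓝[>] 0) (𝓝 h) := by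
    unfold HasDirDeriv at hdd
    rw [hpy] at hdd
    rw [hpdef]; exact hdd
  have hid : Tendsto (fun t : ℝ => t) (𝓝[>] 0) (𝓝 0) := tendsto_id.mono_left nhdsWithin_le_nhds
  have hpt : Tendsto p (𝓝[>] 0) (𝓝 y) := by
    have h1 : Tendsto (fun t : ℝ => y + t • (t⁻¹ • (p t - y))) (𝓝[>] 0) (𝓝 y) := by
      simpa using (hid.smul hp).const_add y
    refine h1.congr' ?_
    filter_upwards [self_mem_nhdsWithin] with t ht
    rw [smul_inv_smul₀ (ne_of_gt ht)]; abel
  have hlh : ⟪l, h⟫ = 0 := by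
    apply le_antisymm
    · have h1 : Tendsto (fun t : ℝ => ⟪l, t⁻¹ • (p t - y)⟫) (𝓝[>] 0) (𝓝 ⟪l, h⟫) :=
        tendsto_const_nhds.inner hp
      refine le_of_tendsto h1 ?_
      filter_upwards [self_mem_nhdsWithin] with t ht
      rw [inner_smul_right]
      exact mul_nonpos_of_nonneg_of_nonpos (inv_nonneg.2 (le_of_lt ht)) (hl.2 _ (hpK t))
    · have h1 : Tendsto (fun t : ℝ => ⟪y + l + t • (h + v) - p t, t⁻¹ • (p t - y)⟫) (𝓝[>] 0)
          (𝓝 ⟪y + l + (0 : ℝ) • (h + v) - y, h⟫) :=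
        (((hid.smul_const (h + v)).const_add (y + l)).sub hpt).inner hp
      have e : y + l + (0 : ℝ) • (h + v) - y = l := by simp
      rw [e] at h1
      refine ge_of_tendsto h1 ?_
      filter_upwards [self_mem_nhdsWithin] with t ht
      rw [inner_smul_right]
      refine mul_nonneg (inv_nonneg.2 (le_of_lt ht)) ?_
      have := hvar 0 t
      rw [hp0, ← neg_sub (p t) y, inner_neg_right] at this
      linarith
  obtain ⟨C, τ, hC, hτ, H⟩ := aux_curve_s17 P (aux_AhD P hpK hp)
  choose! q hqK hqΞ hqC _hqr using H
  obtain ⟨tn, htn⟩ : ∃ tn : ℕ → ℝ, tn = fun n : ℕ => τ * (1 / ((n : ℝ) + 1)) := ⟨_, rfl⟩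
  have htn0 : ∀ n, 0 < tn n := fun n => by rw [htn]; positivity
  have htnτ : ∀ n, tn n ≤ τ := fun n => by
    rw [htn]
    have : 1 / ((n : ℝ) + 1) ≤ 1 := by
      rw [div_le_one (by positivity)]; linarith [Nat.cast_nonneg (α := ℝ) n]
    exact mul_le_of_le_one_right hτ.le this
  have htnt : Tendsto tn atTop (𝓝 0) := by
    rw [htn]
    simpa using (tendsto_one_div_add_atTop_nhds_zero_nat (𝕜 := ℝ)).const_mul τ
  have htnt' : Tendsto tn atTop (𝓝[>] 0) :=
    tendsto_nhdsWithin_iff.2 ⟨htnt, Eventually.of_forall htn0⟩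
  refine ⟨⟨⟨tn, fun n => (tn n)⁻¹ • (p (tn n) - y), htn0, htnt, hp.comp htnt', fun n => ?_⟩, hlh⟩, ?_⟩
  · rw [smul_inv_smul₀ (htn0 n).ne', add_sub_cancel]
    exact hpK _
  obtain ⟨w, hw⟩ : ∃ w : ℕ → E, w = fun n => (2 / (tn n) ^ 2) • (q (tn n) - y - tn n • h) :=
    ⟨_, rfl⟩
  have hwb : ∀ n, w n ∈ closedBall (0 : E) (2 * C) := by
    intro n
    have h1 := hqC (tn n) (htn0 n) (htnτ n)
    have h2 := htn0 n
    rw [mem_closedBall, dist_zero_right, hw]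
    simp only
    rw [norm_smul, Real.norm_of_nonneg (by positivity)]
    calc _ ≤ 2 / (tn n) ^ 2 * (C * (tn n) ^ 2) := mul_le_mul_of_nonneg_left h1 (by positivity)
      _ = 2 * C := by field_simp
  obtain ⟨w0, -, φ, hφ, hlim⟩ := tendsto_subseq_of_bounded (isBounded_closedBall) hwb
  refine ⟨w0, ⟨tn ∘ φ, w ∘ φ, fun n => htn0 _, htnt.comp hφ.tendsto_atTop, hlim, fun n => ?_⟩, ?_⟩
  · have h2 := (htn0 (φ n)).ne'
    have : ((tn ∘ φ) n ^ 2 / 2) • (w ∘ φ) n = q (tn (φ n)) - y - tn (φ n) • h := by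
      simp only [Function.comp, hw]
      rw [smul_smul]
      have : tn (φ n) ^ 2 / 2 * (2 / tn (φ n) ^ 2) = 1 := by field_simp
      rw [this, one_smul]
    rw [this]
    have e : y + (tn ∘ φ) n • h + (q (tn (φ n)) - y - tn (φ n) • h) = q (tn (φ n)) := by
      simp only [Function.comp]; abel
    rw [e]
    exact hqK _ (htn0 _) (htnτ _)
  · refine le_of_forall_pos_le_add fun η hη => ?_
    have hη4 : 0 < η / 4 := by positivity
    have h1 := htnt'.eventually (aux_lower hp0 hp hvar hη4)
    have h2 := htnt'.eventually (aux_upper P hl hlh hpK hp hC hτ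
      (fun t h1 h2 => ⟨hqΞ t h1 h2, hqC t h1 h2⟩) hη4)
    have h3 : ∀ᶠ n in atTop, -⟪v, h⟫ - η ≤ ⟪l, w n⟫ := by
      filter_upwards [h1, h2] with n h1 h2
      have ht := htn0 n
      have e1 : ⟪l, q (tn n) - y - tn n • h⟫ = ⟪l, p (tn n) - y⟫ - ⟪l, p (tn n) - q (tn n)⟫ := by
        rw [inner_sub_right _ _ (tn n • h), inner_smul_right, hlh, ← inner_sub_right]
        rw [sub_sub_sub_cancel_left, mul_zero, sub_zero]
      rw [hw]
      simp only
      rw [inner_smul_right, e1]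
      have e2 : -⟪v, h⟫ - η = 2 / tn n ^ 2 * (-(tn n ^ 2 / 2 * ⟪v, h⟫) - η / 4 * tn n ^ 2
          - η / 4 * tn n ^ 2) := by field_simp; ring
      rw [e2]
      refine mul_le_mul_of_nonneg_left ?_ (by positivity)
      linarith
    have h4 : Tendsto (fun n => ⟪l, w (φ n)⟫) atTop (𝓝 ⟪l, w0⟫) := tendsto_const_nhds.inner hlim
    have := ge_of_tendsto h4 (hφ.tendsto_atTop.eventually h3)
    linarith

end auxsec

/-- the second-order sufficient condition
`⟪d, ∇²ₓₓL(x̄,λ̄)d⟫ − σ(λ̄, T²_K(g(x̄), g'(x̄)d)) > 0` for every nonzero `d` in the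
critical cone `C(x̄) = {d | g'(x̄)d ∈ C_K(g(x̄),λ̄)}` implies that `λ̄` is noncritical.
(The support function is valued in `EReal`: `sSup ∅ = ⊥`.) -/
theorem stmt_17 (f : X → ℝ) (g : X → Y) (K : Set Y)
    (hf : ContDiff ℝ 2 f) (hg : ContDiff ℝ 2 g)
    (hKne : K.Nonempty) (hKcl : IsClosed K) (hKcv : Convex ℝ K)
    (hKred : C2ConeReducible K)
    (x0 : X) (l0 : Y) (hKKT : (x0, l0) ∈ sKKT f g K 0 0)
    (hsosc : ∀ d : X, fderiv ℝ g x0 d ∈ criticalCone K (g x0) l0 → d ≠ 0 →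
      (0 : EReal) < (⟪d, hessLxx f g x0 l0 d⟫ : ℝ) -
        sSup ((fun s : Y => ((⟪l0, s⟫ : ℝ) : EReal)) ''
          secondOrderTangent K (g x0) (fderiv ℝ g x0 d))) :
    Noncritical f g K x0 l0 := by
  intro ξ v h1 h2
  by_contra hξ
  have hl : l0 ∈ nCone K (g x0) := by simpa using hKKT.2
  obtain ⟨hcrit, w, hw, hle⟩ := aux_main hKne hKcl hKcv (hKred _ hl.1) hl h2
  have h3 := hsosc ξ hcrit hξ
  have h4 : ⟪ξ, hessLxx f g x0 l0 ξ⟫ = -⟪v, fderiv ℝ g x0 ξ⟫ := by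
    have := congrArg (fun z => ⟪ξ, z⟫) h1
    simp only [inner_add_right, ContinuousLinearMap.adjoint_inner_right, inner_zero_right] at this
    rw [real_inner_comm v] at this
    linarith
  have h5 : ((⟪ξ, hessLxx f g x0 l0 ξ⟫ : ℝ) : EReal) ≤
      sSup ((fun s : Y => ((⟪l0, s⟫ : ℝ) : EReal)) ''
          secondOrderTangent K (g x0) (fderiv ℝ g x0 ξ)) := by
    refine le_trans ?_ (le_sSup ⟨w, hw, rfl⟩)
    rw [h4]
    exact EReal.coe_le_coe_iff.2 hle
  exact absurd h3 (not_lt.2 (EReal.sub_nonpos.2 h5))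

end
end
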